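/- arXiv:2309.05149 — 5 statements merged into one kernel-verified Lean document; each statement's English description precedes it below -/
import Mathlib

section
/- Let p ∈ (0, 1/4] be a real number, let n and m be integers with 1 ≤ m ≤ n, and let t be a non-negative integer with |t − log_p(m/n)| ≤ 1/2 and t + 1 ≤ n. Then for every subset f of [n] with |f| = t + 1, the probability under G(n,p) that f is a face of N_m(G) (i.e., that f has at least m common neighbors) is at most exp(−m²/(2n)). Equivalently, if B is a binomial random variable with n − t − 1 trials and success probability p^{t+1}, then P(B ≥ m) ≤ exp(−m²/(2n)). -/
open MeasureTheory

/-- Configuration of edge indicators for a graph on vertex set `Fin n`. -/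
abbrev EdgeCfg (n : ℕ) := {e : Sym2 (Fin n) // ¬ e.IsDiag} → Bool

/-- Bernoulli measure on `Bool` with success probability `p`. -/
noncomputable def bern (p : ℝ) : Measure Bool :=
  ENNReal.ofReal p • Measure.dirac true + ENNReal.ofReal (1 - p) • Measure.dirac false

/-- The Erdős–Rényi measure `G(n,p)`: edge indicators are i.i.d. Bernoulli(p). -/
noncomputable def erdosRenyi (n : ℕ) (p : ℝ) : Measure (EdgeCfg n) :=
  Measure.pi fun _ => bern p

/-- `u` and `v` are adjacent in the graph encoded by `ω`. -/
def Adj {n : ℕ} (ω : EdgeCfg n) (u v : Fin n) : Prop :=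
  ∃ h : u ≠ v, ω ⟨s(u, v), by simpa [Sym2.mk_isDiag_iff] using h⟩ = true

open Classical in
/-- The set of common neighbors of `S`. -/
noncomputable def commonNbrs {n : ℕ} (ω : EdgeCfg n) (S : Finset (Fin n)) : Finset (Fin n) :=
  Finset.univ.filter fun v => v ∉ S ∧ ∀ u ∈ S, Adj ω v u

/-- `S` is a face of the `m`-neighbor complex of the graph encoded by `ω`. -/
def IsFace {n : ℕ} (ω : EdgeCfg n) (m : ℕ) (S : Finset (Fin n)) : Prop :=
  m ≤ (commonNbrs ω S).card

open ProbabilityTheory in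
/-- A one-sided Hoeffding bound for the number of occurring events in an independent family of
at most `n` events, each of probability at most `m / (2 * n)`. -/
theorem measureReal_le_card_le_exp {Ω J : Type*} [MeasurableSpace Ω] [Fintype J] {μ : Measure Ω}
    [IsProbabilityMeasure μ] {A : J → Set Ω} (hA : ∀ j, MeasurableSet (A j))
    (hind : iIndepSet A μ) {n m : ℕ} (hm : 1 ≤ m) (hJ : Fintype.card J ≤ n)
    (hq : ∀ j, μ.real (A j) ≤ m / (2 * n)) [∀ ω, DecidablePred fun j => ω ∈ A j] :
    μ.real {ω | m ≤ (Finset.univ.filter fun j => ω ∈ A j).card} ≤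
      Real.exp (-((m : ℝ) ^ 2) / (2 * n)) := by
  have hm0 : (0 : ℝ) < m := by exact_mod_cast hm
  rcases isEmpty_or_nonempty J with hE | hE
  · have : {ω | m ≤ (Finset.univ.filter fun j => ω ∈ A j).card} = ∅ := by
      ext ω
      simp
      omega
    rw [this]
    simpa using (Real.exp_pos _).le
  have hN : (0 : ℝ) < Fintype.card J := by exact_mod_cast Fintype.card_pos
  have hNn : (Fintype.card J : ℝ) ≤ n := by exact_mod_cast hJ
  have hn : (0 : ℝ) < n := hN.trans_le hNn
  set X : J → Ω → ℝ := fun j => (A j).indicator fun _ => (1 : ℝ) with hX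
  have hint : ∀ j, ∫ ω, X j ω ∂μ = μ.real (A j) := fun j => by
    simp [hX, integral_indicator (hA j)]
  have hXi : iIndepFun (fun j ω => X j ω - ∫ x, X j x ∂μ) μ :=
    hind.iIndepFun_indicator.comp (fun j x => x - ∫ x, X j x ∂μ)
      fun j => measurable_id.sub_const _
  have hsub : ∀ j ∈ (Finset.univ : Finset J), HasSubgaussianMGF
      (fun ω => X j ω - ∫ x, X j x ∂μ) ((‖(1 : ℝ) - 0‖₊ / 2) ^ 2) μ := fun j _ => by
    refine hasSubgaussianMGF_of_mem_Icc
      (measurable_const.indicator (hA j)).aemeasurable (.of_forall fun ω => ?_)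
    by_cases h : ω ∈ A j <;> simp [hX, h]
  have key := HasSubgaussianMGF.measure_sum_ge_le_of_iIndepFun hXi hsub
    (ε := (m : ℝ) / 2) (by positivity)
  have hmean : ∑ j, μ.real (A j) ≤ m / 2 := by
    calc ∑ j, μ.real (A j) ≤ ∑ _j : J, (m : ℝ) / (2 * n) := Finset.sum_le_sum fun j _ => hq j
      _ = Fintype.card J * ((m : ℝ) / (2 * n)) := by simp
      _ ≤ n * ((m : ℝ) / (2 * n)) := by gcongr
      _ = m / 2 := by field_simp
  calc μ.real {ω | m ≤ (Finset.univ.filter fun j => ω ∈ A j).card}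
      ≤ μ.real {ω | (m : ℝ) / 2 ≤ ∑ j, (X j ω - ∫ x, X j x ∂μ)} := by
        refine measureReal_mono fun ω hω => ?_
        have hsum : ∑ j, X j ω = ((Finset.univ.filter fun j => ω ∈ A j).card : ℝ) := by
          simp [hX, Set.indicator_apply]
        have hω' : (m : ℝ) ≤ ((Finset.univ.filter fun j => ω ∈ A j).card : ℝ) := by
          exact_mod_cast hω
        simp only [Set.mem_ofPred_eq, Finset.sum_sub_distrib, hsum, hint]
        linarith
    _ ≤ _ := key
    _ ≤ Real.exp (-((m : ℝ) ^ 2) / (2 * n)) := by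
        refine Real.exp_le_exp.2 ?_
        have : -((m : ℝ) / 2) ^ 2 / (2 * ((∑ _j : J, (‖(1 : ℝ) - 0‖₊ / 2) ^ 2 : NNReal) : ℝ)) =
            -((m : ℝ) ^ 2 / (2 * Fintype.card J)) := by
          simp
          field_simp
        rw [this, neg_div]
        gcongr

instance bern.instIsProbabilityMeasure {p : ℝ} [Fact (0 ≤ p)] [Fact (p ≤ 1)] :
    IsProbabilityMeasure (bern p) :=
  ⟨by
    have h0 : 0 ≤ p := Fact.out
    have h1 : p ≤ 1 := Fact.out
    simp [bern, ← ENNReal.ofReal_add h0 (sub_nonneg.2 h1)]⟩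

theorem bern_singleton_true (p : ℝ) : bern p {true} = ENNReal.ofReal p := by
  simp [bern]

/-- The probability that all coordinates in `T` are `true` is `p ^ #T`. -/
theorem pi_bern_forall_true {ι : Type*} [Fintype ι] {p : ℝ} [Fact (0 ≤ p)] [Fact (p ≤ 1)]
    (T : Finset ι) :
    Measure.pi (fun _ : ι => bern p) {ω | ∀ e ∈ T, ω e = true} = ENNReal.ofReal p ^ T.card := by
  classical
  have : {ω : ι → Bool | ∀ e ∈ T, ω e = true} =
      Set.univ.pi fun e => if e ∈ T then {true} else Set.univ := by
    ext ω
    simp only [Set.mem_ofPred_eq, Set.mem_univ_pi]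
    refine forall_congr' fun e => ?_
    by_cases h : e ∈ T <;> simp [h]
  rw [this, Measure.pi_pi]
  simp only [apply_ite (bern p), bern_singleton_true, measure_univ]
  simp

open ProbabilityTheory in
/-- The events that all coordinates in `E j` are `true` are independent for disjoint `E j`. -/
theorem iIndepSet_pi_bern_forall_true {ι J : Type*} [Fintype ι] {p : ℝ} [Fact (0 ≤ p)]
    [Fact (p ≤ 1)] (E : J → Finset ι) (hE : Pairwise fun i j => Disjoint (E i) (E j)) :
    iIndepSet (fun j => {ω : ι → Bool | ∀ e ∈ E j, ω e = true})
      (Measure.pi fun _ : ι => bern p) := by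
  classical
  rw [iIndepSet_iff_meas_biInter fun j => Set.Finite.measurableSet (Set.toFinite _)]
  intro s
  have : ⋂ j ∈ s, {ω : ι → Bool | ∀ e ∈ E j, ω e = true} =
      {ω | ∀ e ∈ s.biUnion E, ω e = true} := by
    ext ω
    simp only [Set.mem_iInter, Set.mem_ofPred_eq, Finset.mem_biUnion]
    grind
  rw [this, pi_bern_forall_true, Finset.card_biUnion fun i _ j _ hij => hE hij]
  simp [pi_bern_forall_true, Finset.prod_pow_eq_pow_sum]

/-- The potential edges joining a vertex `v ∉ f` to the vertices of `f`. -/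
def edgesTo {n : ℕ} (f : Finset (Fin n)) (v : {v // v ∉ f}) :
    Finset {e : Sym2 (Fin n) // ¬ e.IsDiag} :=
  f.attach.map ⟨fun u => ⟨s(v.1, u.1), fun h => v.2 (Sym2.mk_isDiag_iff.1 h ▸ u.2)⟩,
    fun _ _ h => Subtype.ext (Sym2.congr_right.1 (congrArg Subtype.val h))⟩

theorem card_edgesTo {n : ℕ} (f : Finset (Fin n)) (v : {v // v ∉ f}) :
    (edgesTo f v).card = f.card := by
  simp [edgesTo]

theorem pairwise_disjoint_edgesTo {n : ℕ} (f : Finset (Fin n)) :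
    Pairwise fun v w => Disjoint (edgesTo f v) (edgesTo f w) := by
  intro v w hvw
  rw [Finset.disjoint_left]
  intro e hv hw
  simp only [edgesTo, Finset.mem_map, Finset.mem_attach, true_and, Subtype.exists]
    at hv hw
  obtain ⟨a, ha, rfl⟩ := hv
  obtain ⟨b, hb, h⟩ := hw
  rcases Sym2.eq_iff.1 (congrArg Subtype.val h) with ⟨h, -⟩ | ⟨h, -⟩
  · exact hvw (Subtype.ext h.symm)
  · exact w.2 (h ▸ ha)

theorem forall_mem_edgesTo_iff {n : ℕ} (f : Finset (Fin n)) (v : {v // v ∉ f}) (ω : EdgeCfg n) :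
    (∀ e ∈ edgesTo f v, ω e = true) ↔ ∀ u ∈ f, Adj ω v u := by
  simp only [edgesTo, Finset.mem_map, Finset.mem_attach, true_and, Subtype.exists,
    Adj]
  constructor
  · intro h u hu
    exact ⟨fun huv => v.2 (huv ▸ hu), h _ ⟨u, hu, rfl⟩⟩
  · rintro h e ⟨u, hu, rfl⟩
    exact (h u hu).2

open Classical in
theorem card_commonNbrs {n : ℕ} (f : Finset (Fin n)) (ω : EdgeCfg n) :
    (commonNbrs ω f).card = (Finset.univ.filter fun v : {v // v ∉ f} =>
      ω ∈ {ω : EdgeCfg n | ∀ e ∈ edgesTo f v, ω e = true}).card := by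
  rw [← Finset.card_map (Function.Embedding.subtype _)]
  congr 1
  ext v
  simp only [commonNbrs, Set.mem_ofPred_eq, forall_mem_edgesTo_iff, Finset.mem_filter,
    Finset.mem_univ, true_and, Finset.mem_map, Function.Embedding.subtype_apply,
    Subtype.exists, exists_and_right, exists_eq_right]
  grind

theorem pow_succ_le_div_of_abs_sub_log_div_log_le {p : ℝ} (hp0 : 0 < p) (hp1 : p ≤ 1 / 4) {x y : ℝ}
    (hx : 0 < x) (hy : 0 < y) {t : ℕ}
    (ht : |(t : ℝ) - (Real.log x - Real.log y) / Real.log p| ≤ 1 / 2) :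
    p ^ (t + 1) ≤ x / (2 * y) := by
  have hlog4 : Real.log p ≤ -(2 * Real.log 2) := by
    have h := Real.log_le_log hp0 hp1
    rwa [one_div, Real.log_inv, show (4 : ℝ) = 2 ^ 2 by norm_num, Real.log_pow] at h
  have hlog2 : 0 < Real.log 2 := Real.log_pos one_lt_two
  have hlogp : Real.log p < 0 := by linarith
  rw [← Real.log_le_log_iff (by positivity) (by positivity), Real.log_pow,
    Real.log_div hx.ne' (by positivity), Real.log_mul two_ne_zero hy.ne']
  have h := (abs_le.1 ht).1
  have hmul := mul_le_mul_of_nonpos_right h hlogp.le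
  rw [sub_mul, div_mul_cancel₀ _ hlogp.ne] at hmul
  push_cast
  linarith

/-- Lemma 1 of the paper, case $p \le 1/4$: if $|t - \log_p(m/n)| \le 1/2$ and
$t+1\le n$, then any set of $t+1$ vertices is a face of $N_m(G(n,p))$ with
probability at most $\exp(-m^2/(2n))$. -/
theorem stmt0 (p : ℝ) (hp0 : 0 < p) (hp1 : p ≤ 1/4)
    (n m t : ℕ) (hm1 : 1 ≤ m) (hmn : m ≤ n)
    (ht : |(t : ℝ) - (Real.log m - Real.log n) / Real.log p| ≤ 1/2)
    (htn : t + 1 ≤ n)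
    (f : Finset (Fin n)) (hf : f.card = t + 1) :
    erdosRenyi n p {ω | IsFace ω m f} ≤
      ENNReal.ofReal (Real.exp (-((m : ℝ)^2) / (2 * n))) := by
  classical
  have : Fact (0 ≤ p) := ⟨hp0.le⟩
  have : Fact (p ≤ 1) := ⟨by linarith⟩
  have hm0 : (0 : ℝ) < m := by exact_mod_cast hm1
  have hn0 : (0 : ℝ) < n := by exact_mod_cast hm1.trans hmn
  have hq := pow_succ_le_div_of_abs_sub_log_div_log_le hp0 hp1 hm0 hn0 ht
  have key := measureReal_le_card_le_exp (μ := Measure.pi fun _ => bern p)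
    (fun v => Set.Finite.measurableSet (Set.toFinite _))
    (iIndepSet_pi_bern_forall_true (p := p) (edgesTo f) (pairwise_disjoint_edgesTo f)) hm1
    ((Fintype.card_subtype_le _).trans_eq (Fintype.card_fin n)) (fun v => by
      rw [Measure.real, pi_bern_forall_true, card_edgesTo, hf, ENNReal.toReal_pow,
        ENNReal.toReal_ofReal hp0.le]
      exact hq)
  simp only [erdosRenyi, IsFace, card_commonNbrs]
  rw [← ofReal_measureReal]
  exact ENNReal.ofReal_le_ofReal (by convert key)
end

section
/- Fix positive integers m and k and a real number b with 0 < b < k, and for each n let p_n = n^{−1/b}. Then the probability under G(n, p_n) that every k-element subset of [n] is a face of N_m(G) (i.e., has at least m common neighbors) tends to 0 as n → ∞. -/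
open MeasureTheory

instance bern.instIsFiniteMeasure (p : ℝ) : IsFiniteMeasure (bern p) :=
  ⟨by simp [bern]⟩

theorem bern_univ {p : ℝ} (hp0 : 0 ≤ p) (hp1 : p ≤ 1) : bern p Set.univ = 1 := by
  simp [bern, ← ENNReal.ofReal_add hp0 (sub_nonneg.2 hp1)]

/-- The probability that all edges of a given set are present. -/
theorem erdosRenyi_forall_mem_eq_true (n : ℕ) {p : ℝ} (hp0 : 0 ≤ p) (hp1 : p ≤ 1)
    (T : Finset {e : Sym2 (Fin n) // ¬ e.IsDiag}) :
    erdosRenyi n p {ω | ∀ e ∈ T, ω e = true} = ENNReal.ofReal p ^ T.card := by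
  classical
  have hbox : {ω : EdgeCfg n | ∀ e ∈ T, ω e = true} =
      Set.pi Set.univ fun e => if e ∈ T then {true} else Set.univ := by
    ext ω
    simp only [Set.mem_ofPred_eq, Set.mem_pi, Set.mem_univ, true_implies]
    refine forall_congr' fun e => ?_
    split_ifs with h <;> simp [h]
  rw [hbox, erdosRenyi, Measure.pi_pi]
  have hfactor (e : {e : Sym2 (Fin n) // ¬ e.IsDiag}) :
      bern p (if e ∈ T then {true} else Set.univ) = if e ∈ T then ENNReal.ofReal p else 1 := by
    split_ifs
    · exact bern_singleton_true p
    · exact bern_univ hp0 hp1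
  rw [Finset.prod_congr rfl fun e _ => hfactor e]
  simp [Finset.prod_ite_mem]

theorem erdosRenyi_forall_adj (n : ℕ) {p : ℝ} (hp0 : 0 ≤ p) (hp1 : p ≤ 1)
    {S : Finset (Fin n)} {v : Fin n} (hv : v ∉ S) :
    erdosRenyi n p {ω | ∀ u ∈ S, Adj ω v u} = ENNReal.ofReal p ^ S.card := by
  classical
  have hne (u : S) : v ≠ u := fun h => hv (h ▸ u.2)
  let edge (u : S) : {e : Sym2 (Fin n) // ¬ e.IsDiag} :=
    ⟨s(v, u), by simpa [Sym2.mk_isDiag_iff] using hne u⟩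
  have hinj : Function.Injective edge := fun u w h => by
    have h' : s(v, (u : Fin n)) = s(v, (w : Fin n)) := congrArg Subtype.val h
    exact Subtype.ext (Sym2.congr_right.1 h')
  have hset : {ω : EdgeCfg n | ∀ u ∈ S, Adj ω v u} =
      {ω | ∀ e ∈ S.attach.image edge, ω e = true} := by
    ext ω
    simp only [Set.mem_ofPred_eq, Finset.forall_mem_image]
    exact ⟨fun h u _ => (h u u.2).2, fun h u hu => ⟨hne ⟨u, hu⟩, h (Finset.mem_attach S ⟨u, hu⟩)⟩⟩
  rw [hset, erdosRenyi_forall_mem_eq_true n hp0 hp1, Finset.card_image_of_injective _ hinj,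
    Finset.card_attach]

/-- First moment bound for the probability that `S` has at least `m ≥ 1` common neighbors. -/
theorem erdosRenyi_isFace_le {n m : ℕ} (hm : 0 < m) {p : ℝ} (hp0 : 0 ≤ p) (hp1 : p ≤ 1)
    (S : Finset (Fin n)) :
    erdosRenyi n p {ω | IsFace ω m S} ≤ n * ENNReal.ofReal p ^ S.card := by
  classical
  have hsub : {ω : EdgeCfg n | IsFace ω m S} ⊆
      ⋃ v ∈ Finset.univ.filter (· ∉ S), {ω | ∀ u ∈ S, Adj ω v u} := by
    intro ω hω
    obtain ⟨v, hv⟩ := Finset.card_pos.1 (hm.trans_le hω)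
    have hv : v ∉ S ∧ ∀ u ∈ S, Adj ω v u := by simpa [commonNbrs] using hv
    exact Set.mem_biUnion (by simpa using hv.1) hv.2
  calc erdosRenyi n p {ω | IsFace ω m S}
      ≤ ∑ v ∈ Finset.univ.filter (· ∉ S), erdosRenyi n p {ω | ∀ u ∈ S, Adj ω v u} :=
        (measure_mono hsub).trans (measure_biUnion_finset_le _ _)
    _ = ∑ v ∈ Finset.univ.filter (· ∉ S), ENNReal.ofReal p ^ S.card :=
        Finset.sum_congr rfl fun v hv =>
          erdosRenyi_forall_adj n hp0 hp1 (Finset.mem_filter.1 hv).2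
    _ ≤ ∑ _v : Fin n, ENNReal.ofReal p ^ S.card :=
        Finset.sum_le_sum_of_subset (Finset.filter_subset _ _)
    _ = n * ENNReal.ofReal p ^ S.card := by simp

/-- Lemma 4, lower direction: if $0 < b < k$ and $p_n = n^{-1/b}$, the probability
that every $k$-set of vertices is a face of $N_m(G(n,p_n))$ tends to $0$. -/
theorem stmt10 (m k : ℕ) (hm : 0 < m) (hk : 0 < k) (b : ℝ) (hb0 : 0 < b) (hbk : b < k) :
    Filter.Tendsto
      (fun n : ℕ => erdosRenyi n ((n : ℝ) ^ (-(1/b)))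
        {ω | ∀ S : Finset (Fin n), S.card = k → IsFace ω m S})
      Filter.atTop (nhds 0) := by
  have hexp : 0 < k / b - 1 := sub_pos.2 ((one_lt_div hb0).2 hbk)
  have hlim : Filter.Tendsto (fun n : ℕ => ENNReal.ofReal ((n : ℝ) ^ (-(k / b - 1))))
      Filter.atTop (nhds 0) := by
    simpa using ENNReal.tendsto_ofReal
      ((tendsto_rpow_neg_atTop hexp).comp tendsto_natCast_atTop_atTop)
  refine tendsto_of_tendsto_of_tendsto_of_le_of_le' tendsto_const_nhds hlim
    (Filter.Eventually.of_forall fun _ => zero_le) ?_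
  filter_upwards [Filter.eventually_ge_atTop k] with n hkn
  have hn : 1 ≤ (n : ℝ) := by exact_mod_cast hk.trans_le hkn
  have hn0 : 0 < (n : ℝ) := one_pos.trans_le hn
  have hp0 : 0 ≤ (n : ℝ) ^ (-(1 / b)) := Real.rpow_nonneg hn0.le _
  have hp1 : (n : ℝ) ^ (-(1 / b)) ≤ 1 :=
    Real.rpow_le_one_of_one_le_of_nonpos hn (neg_nonpos.2 (one_div_pos.2 hb0).le)
  obtain ⟨S, -, hS⟩ := Finset.exists_subset_card_eq
    (s := (Finset.univ : Finset (Fin n))) (n := k) (by simpa using hkn)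
  calc erdosRenyi n ((n : ℝ) ^ (-(1 / b))) {ω | ∀ S : Finset (Fin n), S.card = k → IsFace ω m S}
      ≤ erdosRenyi n ((n : ℝ) ^ (-(1 / b))) {ω | IsFace ω m S} :=
        measure_mono fun ω hω => hω S hS
    _ ≤ n * ENNReal.ofReal ((n : ℝ) ^ (-(1 / b))) ^ k :=
        hS ▸ erdosRenyi_isFace_le hm hp0 hp1 S
    _ = ENNReal.ofReal ((n : ℝ) ^ (-(k / b - 1))) := by
        rw [← ENNReal.ofReal_natCast n, ← ENNReal.ofReal_pow hp0,
          ← ENNReal.ofReal_mul hn0.le, ← Real.rpow_mul_natCast hn0.le]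
        congr 1
        rw [← Real.rpow_one_add' hn0.le (by
          have : (1 : ℝ) + -(1 / b) * k = -(k / b - 1) := by ring
          rw [this]; exact (neg_neg_of_pos hexp).ne)]
        congr 1
        ring
end

section
/- Fix positive integers m and k and a real number b with b > mk/(m+k), and for each n let p_n = n^{−1/b}. Then the probability under G(n, p_n) that there exists some k-element subset of [n] that is a face of N_m(G) (i.e., has at least m common neighbors) tends to 1 as n → ∞. -/
open MeasureTheory

/-- Second moment method for a finite family of events. -/
lemma one_sub_le_measureReal_iUnion {Ω ι : Type*} [Fintype ι] [MeasurableSpace Ω]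
    (μ : Measure Ω) [IsProbabilityMeasure μ] (A : ι → Set Ω) (hA : ∀ i, MeasurableSet (A i))
    (c ε : ℝ) (hc : 0 < c) (h₁ : ∑ i, μ.real (A i) = c)
    (h₂ : ∑ i, ∑ j, μ.real (A i ∩ A j) ≤ c ^ 2 * (1 + ε)) :
    1 - ε ≤ μ.real (⋃ i, A i) := by
  have hU : MeasurableSet (⋃ i, A i) := .iUnion hA
  have hind (s : Set Ω) (hs : MeasurableSet s) :
      Integrable (s.indicator (fun _ => (1 : ℝ))) μ := (integrable_const 1).indicator hs
  have hI (s : Set Ω) (hs : MeasurableSet s) :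
      ∫ ω, s.indicator (fun _ => (1 : ℝ)) ω ∂μ = μ.real s := by
    rw [integral_indicator hs]; simp
  have hX : Integrable (fun ω => ∑ i, (A i).indicator (fun _ => (1 : ℝ)) ω) μ :=
    integrable_finsetSum _ fun i _ => hind _ (hA i)
  have hXX : Integrable
      (fun ω => ∑ i, ∑ j, (A i ∩ A j).indicator (fun _ => (1 : ℝ)) ω) μ :=
    integrable_finsetSum _ fun i _ => integrable_finsetSum _ fun j _ =>
      hind _ ((hA i).inter (hA j))
  have key : ∫ ω, c ^ 2 * (⋃ i, A i)ᶜ.indicator (fun _ => (1 : ℝ)) ω ∂μ ≤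
      ∫ ω, ((∑ i, ∑ j, (A i ∩ A j).indicator (fun _ => (1 : ℝ)) ω)
        - 2 * c * (∑ i, (A i).indicator (fun _ => (1 : ℝ)) ω)) + c ^ 2 ∂μ := by
    refine integral_mono ((hind _ hU.compl).const_mul _)
      ((hXX.sub (hX.const_mul _)).add (integrable_const _)) fun ω => ?_
    have hsq : ∑ i, ∑ j, (A i ∩ A j).indicator (fun _ => (1 : ℝ)) ω =
        (∑ i, (A i).indicator (fun _ => (1 : ℝ)) ω) ^ 2 := by
      simp_rw [sq, Finset.sum_mul_sum]
      refine Finset.sum_congr rfl fun i _ => Finset.sum_congr rfl fun j _ => ?_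
      by_cases hi : ω ∈ A i <;> by_cases hj : ω ∈ A j <;> simp [hi, hj]
    simp only [hsq]
    by_cases hω : ω ∈ ⋃ i, A i
    · rw [Set.indicator_of_notMem (by simpa using hω)]
      nlinarith [sq_nonneg (∑ i, (A i).indicator (fun _ => (1 : ℝ)) ω - c)]
    · have h0 : ∑ i, (A i).indicator (fun _ => (1 : ℝ)) ω = 0 :=
        Finset.sum_eq_zero fun i _ =>
          Set.indicator_of_notMem (fun h => hω (Set.mem_iUnion_of_mem i h)) _
      rw [Set.indicator_of_mem (by simpa using hω), h0]
      simp
  rw [integral_const_mul, hI _ hU.compl,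
    integral_add (by exact hXX.sub (hX.const_mul _)) (integrable_const _),
    integral_sub hXX (hX.const_mul _), integral_const_mul,
    integral_finsetSum _ (fun i _ => hind _ (hA i)),
    integral_finsetSum _ (fun i _ => integrable_finsetSum _ fun j _ =>
      hind _ ((hA i).inter (hA j)))] at key
  simp_rw [integral_finsetSum _ (fun j _ => hind _ ((hA _).inter (hA j))),
    hI _ (hA _), hI _ ((hA _).inter (hA _)), h₁, probReal_compl_eq_one_sub hU] at key
  simp only [integral_const, probReal_univ, smul_eq_mul, one_mul] at key
  have : c ^ 2 * (1 - μ.real (⋃ i, A i)) ≤ c ^ 2 * ε := by nlinarith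
  have := le_of_mul_le_mul_left this (by positivity)
  linarith

lemma isProbabilityMeasure_bern {p : ℝ} (h₀ : 0 ≤ p) (h₁ : p ≤ 1) :
    IsProbabilityMeasure (bern p) := by
  constructor
  simp only [bern, Measure.add_apply, Measure.smul_apply, measure_univ, smul_eq_mul, mul_one]
  rw [← ENNReal.ofReal_add h₀ (by linarith)]
  simp

lemma isProbabilityMeasure_erdosRenyi (n : ℕ) {p : ℝ} (h₀ : 0 ≤ p) (h₁ : p ≤ 1) :
    IsProbabilityMeasure (erdosRenyi n p) := by
  have := isProbabilityMeasure_bern h₀ h₁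
  unfold erdosRenyi
  infer_instance

lemma erdosRenyi_real_forall_mem (n : ℕ) {p : ℝ} (h₀ : 0 ≤ p) (h₁ : p ≤ 1)
    (F : Finset {e : Sym2 (Fin n) // ¬ e.IsDiag}) :
    (erdosRenyi n p).real {ω | ∀ e ∈ F, ω e = true} = p ^ F.card := by
  classical
  have := isProbabilityMeasure_bern h₀ h₁
  have hset : {ω : EdgeCfg n | ∀ e ∈ F, ω e = true} =
      Set.univ.pi fun e => if e ∈ F then {true} else Set.univ := by
    ext ω
    simp only [Set.mem_ofPred_eq, Set.mem_pi, Set.mem_univ, true_implies]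
    refine forall_congr' fun e => ?_
    by_cases he : e ∈ F <;> simp [he]
  have htrue : bern p {true} = ENNReal.ofReal p := by simp [bern]
  rw [Measure.real, hset, erdosRenyi, Measure.pi_pi]
  have hfac (e : {e : Sym2 (Fin n) // ¬ e.IsDiag}) :
      bern p (if e ∈ F then {true} else Set.univ) = if e ∈ F then ENNReal.ofReal p else 1 := by
    split_ifs
    · exact htrue
    · exact measure_univ
  simp_rw [hfac, Finset.prod_ite_mem, Finset.univ_inter, Finset.prod_const]
  rw [← ENNReal.ofReal_pow h₀, ENNReal.toReal_ofReal (by positivity)]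

/-- The graph of a function between finite types, as a finset. -/
def finsetGraph {α β : Type*} [Fintype α] (x : α → β) : Finset (α × β) :=
  Finset.univ.map ⟨fun i => (i, x i), fun _ _ h => (Prod.ext_iff.1 h).1⟩

lemma mem_finsetGraph {α β : Type*} [Fintype α] {x : α → β} {z : α × β} :
    z ∈ finsetGraph x ↔ x z.1 = z.2 := by
  rcases z with ⟨a, b⟩
  refine Finset.mem_map.trans ⟨?_, fun h => ⟨a, Finset.mem_univ a, Prod.ext rfl h⟩⟩
  rintro ⟨i, -, h⟩
  cases h
  rfl

lemma card_finsetGraph {α β : Type*} [Fintype α] (x : α → β) :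
    (finsetGraph x).card = Fintype.card α := by
  simp [finsetGraph]

/-- The set where two functions agree. -/
def agreeSet {α β : Type*} [Fintype α] [DecidableEq β] (x x' : α → β) : Finset α :=
  Finset.univ.filter fun i => x i = x' i

lemma card_finsetGraph_inter {α β : Type*} [Fintype α] [DecidableEq α] [DecidableEq β]
    (x x' : α → β) :
    (finsetGraph x ∩ finsetGraph x').card = (agreeSet x x').card := by
  symm
  refine Finset.card_bij (fun i _ => (i, x i)) ?_ ?_ ?_
  · intro i hi
    simp only [agreeSet, Finset.mem_filter, Finset.mem_univ, true_and] at hi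
    simp [mem_finsetGraph, hi]
  · intro i _ j _ h
    exact (Prod.ext_iff.1 h).1
  · rintro ⟨i, a⟩ h
    simp only [Finset.mem_inter, mem_finsetGraph] at h
    exact ⟨i, by simp [agreeSet, h.1, h.2], by simp [h.1]⟩

lemma card_filter_subset_agreeSet {α β : Type*} [Fintype α] [DecidableEq α] [Fintype β]
    [DecidableEq β] (x : α → β) (I : Finset α) :
    (Finset.univ.filter fun x' : α → β => I ⊆ agreeSet x x').card * Fintype.card β ^ I.card =
      Fintype.card β ^ Fintype.card α := by
  have h : (Finset.univ.filter fun x' : α → β => I ⊆ agreeSet x x') =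
      Fintype.piFinset fun i => if i ∈ I then {x i} else Finset.univ := by
    ext x'
    simp only [Finset.mem_filter, Finset.mem_univ, true_and, Fintype.mem_piFinset,
      Finset.subset_iff, agreeSet]
    refine forall_congr' fun i => ?_
    by_cases hi : i ∈ I <;> simp [hi, eq_comm]
  rw [h, Fintype.card_piFinset]
  have hfac (i : α) : (if i ∈ I then {x i} else Finset.univ : Finset β).card =
      if i ∈ Iᶜ then Fintype.card β else 1 := by
    by_cases hi : i ∈ I <;> simp [hi]
  simp_rw [hfac, Finset.prod_ite_mem, Finset.univ_inter, Finset.prod_const]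
  rw [← pow_add, Finset.card_compl_add_card]

/-- The sum over pairs of nonempty index sets which bounds the relative variance of the number
of complete bipartite graphs. -/
noncomputable def relVarBound (k m N : ℕ) (p : ℝ) : ℝ :=
  ∑ I : Finset (Fin k), ∑ J : Finset (Fin m),
    if I.Nonempty ∧ J.Nonempty then ((N : ℝ) ^ (I.card + J.card) * p ^ (I.card * J.card))⁻¹ else 0

lemma sum_inv_pow_agreeSet_le (k m N : ℕ) (hN : 0 < N) {p : ℝ} (hp : 0 < p) :
    ∑ t : (Fin k → Fin N) × (Fin m → Fin N), ∑ t' : (Fin k → Fin N) × (Fin m → Fin N),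
      (p ^ ((agreeSet t.1 t'.1).card * (agreeSet t.2 t'.2).card))⁻¹ ≤
    ((N : ℝ) ^ (k + m)) ^ 2 * (1 + relVarBound k m N p) := by
  have hN' : (0 : ℝ) < N := by exact_mod_cast hN
  have hcount {a : ℕ} (x : Fin a → Fin N) (I : Finset (Fin a)) :
      ∑ x' : Fin a → Fin N, (if I ⊆ agreeSet x x' then (1 : ℝ) else 0) =
        (N : ℝ) ^ a * ((N : ℝ) ^ I.card)⁻¹ := by
    have h := card_filter_subset_agreeSet x I
    simp only [Fintype.card_fin] at h
    rw [Finset.sum_boole, eq_mul_inv_iff_mul_eq₀ (by positivity)]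
    exact_mod_cast h
  have hrow (t : (Fin k → Fin N) × (Fin m → Fin N)) :
      ∑ t' : (Fin k → Fin N) × (Fin m → Fin N),
        (p ^ ((agreeSet t.1 t'.1).card * (agreeSet t.2 t'.2).card))⁻¹ ≤
      (N : ℝ) ^ (k + m) * (1 + relVarBound k m N p) := by
    calc
      _ ≤ ∑ t' : (Fin k → Fin N) × (Fin m → Fin N), (1 +
            ∑ I : Finset (Fin k), ∑ J : Finset (Fin m), if I.Nonempty ∧ J.Nonempty then
              (p ^ (I.card * J.card))⁻¹ * ((if I ⊆ agreeSet t.1 t'.1 then (1 : ℝ) else 0) *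
                (if J ⊆ agreeSet t.2 t'.2 then (1 : ℝ) else 0)) else 0) := by
        refine Finset.sum_le_sum fun t' _ => ?_
        set I₀ := agreeSet t.1 t'.1
        set J₀ := agreeSet t.2 t'.2
        have hnn (I : Finset (Fin k)) (J : Finset (Fin m)) :
            0 ≤ if I.Nonempty ∧ J.Nonempty then
              (p ^ (I.card * J.card))⁻¹ * ((if I ⊆ I₀ then (1 : ℝ) else 0) *
                (if J ⊆ J₀ then (1 : ℝ) else 0)) else 0 := by
          split_ifs <;> simp <;> positivity
        by_cases h : I₀.Nonempty ∧ J₀.Nonempty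
        · have h1 := Finset.single_le_sum (fun J _ => hnn I₀ J) (Finset.mem_univ J₀)
          have h2 := Finset.single_le_sum
            (fun I _ => Finset.sum_nonneg fun J (_ : J ∈ Finset.univ) => hnn I J)
            (Finset.mem_univ I₀)
          rw [if_pos h] at h1
          simp only [Finset.Subset.refl, if_true, mul_one] at h1 h2
          linarith
        · have h0 : I₀.card * J₀.card = 0 := by
            rw [not_and_or, Finset.not_nonempty_iff_eq_empty,
              Finset.not_nonempty_iff_eq_empty] at h
            rcases h with h | h <;> simp [h]
          rw [h0, pow_zero, inv_one]
          exact le_add_of_nonneg_right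
            (Finset.sum_nonneg fun I _ => Finset.sum_nonneg fun J _ => hnn I J)
      _ = _ := by
        rw [Finset.sum_add_distrib, mul_add]
        congr 1
        · simp [pow_add]
        · rw [Finset.sum_comm, relVarBound, Finset.mul_sum]
          refine Finset.sum_congr rfl fun I _ => ?_
          rw [Finset.sum_comm, Finset.mul_sum]
          refine Finset.sum_congr rfl fun J _ => ?_
          split_ifs
          · have hprod :
                ∑ t' : (Fin k → Fin N) × (Fin m → Fin N),
                  (if I ⊆ agreeSet t.1 t'.1 then (1 : ℝ) else 0) *
                    (if J ⊆ agreeSet t.2 t'.2 then (1 : ℝ) else 0) =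
                (∑ x' : Fin k → Fin N, if I ⊆ agreeSet t.1 x' then (1 : ℝ) else 0) *
                  ∑ y' : Fin m → Fin N, if J ⊆ agreeSet t.2 y' then (1 : ℝ) else 0 := by
              rw [Fintype.sum_prod_type, Fintype.sum_mul_sum]
            rw [← Finset.mul_sum, hprod, hcount, hcount, pow_add, pow_add, mul_inv, mul_inv]
            ring
          · simp
  calc
    _ ≤ ∑ _t : (Fin k → Fin N) × (Fin m → Fin N),
        (N : ℝ) ^ (k + m) * (1 + relVarBound k m N p) := Finset.sum_le_sum fun t _ => hrow t
    _ = _ := by simp [pow_add]; ring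

lemma one_sub_relVarBound_le (m k n N : ℕ) (hN : 0 < N) (hn : (k + m) * N ≤ n)
    {p : ℝ} (h₀ : 0 < p) (h₁ : p ≤ 1) :
    1 - relVarBound k m N p ≤
      (erdosRenyi n p).real {ω | ∃ S : Finset (Fin n), S.card = k ∧ IsFace ω m S} := by
  classical
  have := isProbabilityMeasure_erdosRenyi n h₀.le h₁
  obtain ⟨f⟩ : Nonempty ((Fin k ⊕ Fin m) × Fin N ↪ Fin n) :=
    Function.Embedding.nonempty_of_card_le (by simpa using hn)
  have hne (z : (Fin k × Fin N) × (Fin m × Fin N)) :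
      f (Sum.inr z.2.1, z.2.2) ≠ f (Sum.inl z.1.1, z.1.2) := fun h => by
    simpa using f.injective h
  let e : (Fin k × Fin N) × (Fin m × Fin N) ↪ {e : Sym2 (Fin n) // ¬ e.IsDiag} :=
    ⟨fun z => ⟨s(f (Sum.inr z.2.1, z.2.2), f (Sum.inl z.1.1, z.1.2)),
      by simp [Sym2.mk_isDiag_iff]⟩, by
      rintro ⟨⟨i, a⟩, ⟨j, b⟩⟩ ⟨⟨i', a'⟩, ⟨j', b'⟩⟩ h
      have h := Subtype.ext_iff.1 h
      simp only [Sym2.eq_iff, f.injective.eq_iff, Prod.mk.injEq, Sum.inl.injEq, Sum.inr.injEq,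
        reduceCtorEq, false_and, and_false, or_false] at h
      simp [h.1.1, h.1.2, h.2.1, h.2.2]⟩
  let F (t : (Fin k → Fin N) × (Fin m → Fin N)) : Finset {e : Sym2 (Fin n) // ¬ e.IsDiag} :=
    (finsetGraph t.1 ×ˢ finsetGraph t.2).map e
  let A (t : (Fin k → Fin N) × (Fin m → Fin N)) : Set (EdgeCfg n) :=
    {ω | ∀ e ∈ F t, ω e = true}
  have hF (t) : (F t).card = k * m := by
    simp [F, Finset.card_product, card_finsetGraph]
  have hFF (t t') : (F t ∪ F t').card +
      (agreeSet t.1 t'.1).card * (agreeSet t.2 t'.2).card = 2 * (k * m) := by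
    have h := Finset.card_union_add_card_inter (F t) (F t')
    rw [hF, hF] at h
    simp only [F] at h ⊢
    rw [← Finset.map_inter, Finset.card_map, Finset.product_inter_product,
      Finset.card_product, card_finsetGraph_inter, card_finsetGraph_inter] at h
    omega
  have hAA (t t') : (erdosRenyi n p).real (A t ∩ A t') =
      p ^ (2 * (k * m)) * (p ^ ((agreeSet t.1 t'.1).card * (agreeSet t.2 t'.2).card))⁻¹ := by
    have hset : A t ∩ A t' = {ω | ∀ e ∈ F t ∪ F t', ω e = true} := by
      ext ω
      simp only [A, Set.mem_inter_iff, Set.mem_ofPred_eq, Finset.mem_union, or_imp,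
        forall_and]
    rw [hset, erdosRenyi_real_forall_mem n h₀.le h₁, ← hFF t t', pow_add,
      mul_inv_cancel_right₀ (by positivity)]
  have hN' : (0 : ℝ) < N := by exact_mod_cast hN
  have hU : 1 - relVarBound k m N p ≤ (erdosRenyi n p).real (⋃ t, A t) := by
    refine one_sub_le_measureReal_iUnion _ A (fun t => .of_discrete)
      ((N : ℝ) ^ (k + m) * p ^ (k * m)) _ (by positivity) ?_ ?_
    · simp only [A, erdosRenyi_real_forall_mem n h₀.le h₁, hF]
      simp [pow_add]
    · simp_rw [hAA, ← Finset.mul_sum]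
      refine (mul_le_mul_of_nonneg_left (sum_inv_pow_agreeSet_le k m N hN h₀)
        (by positivity)).trans (le_of_eq ?_)
      ring
  refine hU.trans (measureReal_mono (Set.iUnion_subset fun t ω hω => ?_))
  have hadj (i : Fin k) (j : Fin m) :
      Adj ω (f (Sum.inr j, t.2 j)) (f (Sum.inl i, t.1 i)) :=
    ⟨hne ((i, t.1 i), (j, t.2 j)), hω (e ((i, t.1 i), (j, t.2 j))) (by
      refine Finset.mem_map_of_mem _ ?_
      simp [mem_finsetGraph])⟩
  let S : Finset (Fin n) := Finset.univ.image fun i : Fin k => f (Sum.inl i, t.1 i)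
  let T : Finset (Fin n) := Finset.univ.image fun j : Fin m => f (Sum.inr j, t.2 j)
  have hS : S.card = k := by
    rw [Finset.card_image_of_injective _ fun i j h => by
      simpa using congrArg Prod.fst (f.injective h)]
    simp
  have hT : T.card = m := by
    rw [Finset.card_image_of_injective _ fun i j h => by
      simpa using congrArg Prod.fst (f.injective h)]
    simp
  refine ⟨S, hS, ?_⟩
  rw [IsFace]
  refine hT.symm.le.trans (Finset.card_le_card fun v hv => ?_)
  obtain ⟨j, -, rfl⟩ := Finset.mem_image.1 hv
  simp only [commonNbrs, Finset.mem_filter, Finset.mem_univ, true_and]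
  refine ⟨fun h => ?_, fun u hu => ?_⟩
  · obtain ⟨i, -, hi⟩ := Finset.mem_image.1 h
    exact hne ((i, t.1 i), (j, t.2 j)) hi.symm
  · obtain ⟨i, -, rfl⟩ := Finset.mem_image.1 hu
    exact hadj i j

lemma tendsto_div_pow_mul_rpow_pow_atTop {K i j : ℕ} (hK : 0 < K) {b : ℝ} (hb : 0 < b)
    (hij : (i : ℝ) * j < b * (i + j)) :
    Filter.Tendsto
      (fun n : ℕ => ((n / K : ℕ) : ℝ) ^ (i + j) * ((n : ℝ) ^ (-(1 / b))) ^ (i * j))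
      Filter.atTop Filter.atTop := by
  have hexp : 0 < (i + j : ℝ) - i * j / b := by
    rw [sub_pos, div_lt_iff₀ hb]; linarith
  have hlim := ((tendsto_rpow_atTop hexp).comp tendsto_natCast_atTop_atTop).const_mul_atTop
    (show (0 : ℝ) < ((2 * K : ℝ) ^ (i + j))⁻¹ by positivity)
  refine Filter.tendsto_atTop_mono' _ ?_ hlim
  filter_upwards [Filter.eventually_ge_atTop K] with n hn
  have hn0 : (0 : ℝ) < n := by exact_mod_cast hK.trans_le hn
  have hdiv : n ≤ 2 * K * (n / K) := by
    have h1 := Nat.div_add_mod n K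
    have h2 := Nat.mod_lt n hK
    have h3 : K * 1 ≤ K * (n / K) := Nat.mul_le_mul_left K (Nat.div_pos hn hK)
    rw [mul_assoc]
    omega
  have hdiv' : (n : ℝ) / (2 * K) ≤ ((n / K : ℕ) : ℝ) := by
    rw [div_le_iff₀ (by positivity), mul_comm]
    exact_mod_cast hdiv
  calc
    _ = ((n : ℝ) / (2 * K)) ^ (i + j) * ((n : ℝ) ^ (-(1 / b))) ^ (i * j) := by
      have e1 : ((n : ℝ) ^ (-(1 / b))) ^ (i * j) = (n : ℝ) ^ (-(i * j / b : ℝ)) := by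
        rw [← Real.rpow_mul_natCast hn0.le]
        congr 1
        push_cast
        ring
      have e2 : (n : ℝ) ^ ((i + j : ℝ) - i * j / b) =
          (n : ℝ) ^ (i + j) * (n : ℝ) ^ (-(i * j / b : ℝ)) := by
        rw [sub_eq_add_neg, Real.rpow_add hn0, ← Nat.cast_add, Real.rpow_natCast]
      rw [e1, Function.comp_apply, e2, div_pow]
      ring
    _ ≤ _ := by gcongr

lemma tendsto_relVarBound (m k : ℕ) (hm : 0 < m) (hk : 0 < k) {b : ℝ}
    (hbk : (m : ℝ) * k / (m + k) < b) :
    Filter.Tendsto (fun n : ℕ => relVarBound k m (n / (k + m)) ((n : ℝ) ^ (-(1 / b))))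
      Filter.atTop (nhds 0) := by
  have hm' : (0 : ℝ) < m := by exact_mod_cast hm
  have hk' : (0 : ℝ) < k := by exact_mod_cast hk
  have hb : 0 < b := lt_trans (by positivity) hbk
  rw [div_lt_iff₀ (by positivity)] at hbk
  have hterm (I : Finset (Fin k)) (J : Finset (Fin m)) : Filter.Tendsto
      (fun n : ℕ => if I.Nonempty ∧ J.Nonempty then
        (((n / (k + m) : ℕ) : ℝ) ^ (I.card + J.card) *
          ((n : ℝ) ^ (-(1 / b))) ^ (I.card * J.card))⁻¹ else 0) Filter.atTop (nhds 0) := by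
    split_ifs with h
    · refine (tendsto_div_pow_mul_rpow_pow_atTop (by omega) hb ?_).inv_tendsto_atTop
      have hi : (0 : ℝ) < I.card := by exact_mod_cast h.1.card_pos
      have hj : (0 : ℝ) < J.card := by exact_mod_cast h.2.card_pos
      have hik : (I.card : ℝ) ≤ k := by exact_mod_cast card_finset_fin_le I
      have hjm : (J.card : ℝ) ≤ m := by exact_mod_cast card_finset_fin_le J
      have h1 : (I.card * J.card : ℝ) * k ≤ (I.card * m) * k := by gcongr
      have h2 : (I.card * J.card : ℝ) * m ≤ (k * J.card) * m := by gcongr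
      have h3 : (m * k : ℝ) * (I.card + J.card) < (b * (m + k)) * (I.card + J.card) := by gcongr
      refine lt_of_mul_lt_mul_right (a := (m + k : ℝ)) ?_ (by positivity)
      linarith
    · exact tendsto_const_nhds
  have := tendsto_finsetSum (Finset.univ : Finset (Finset (Fin k))) fun I _ =>
    tendsto_finsetSum (Finset.univ : Finset (Finset (Fin m))) fun J _ => hterm I J
  simpa [relVarBound] using this

/-- Lemma 5, upper direction: if $b > mk/(m+k)$ and $p_n = n^{-1/b}$, the probability
that some $k$-set of vertices is a face of $N_m(G(n,p_n))$ tends to $1$. -/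
theorem stmt13 (m k : ℕ) (hm : 0 < m) (hk : 0 < k) (b : ℝ)
    (hbk : (m : ℝ) * k / (m + k) < b) :
    Filter.Tendsto
      (fun n : ℕ => erdosRenyi n ((n : ℝ) ^ (-(1/b)))
        {ω | ∃ S : Finset (Fin n), S.card = k ∧ IsFace ω m S})
      Filter.atTop (nhds 1) := by
  have hb : 0 < b := lt_of_le_of_lt (by positivity) hbk
  have hp (n : ℕ) (hn : 0 < n) : 0 < (n : ℝ) ^ (-(1 / b)) ∧ (n : ℝ) ^ (-(1 / b)) ≤ 1 := by
    have hn' : (1 : ℝ) ≤ n := by exact_mod_cast hn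
    exact ⟨by positivity, Real.rpow_le_one_of_one_le_of_nonpos hn' (by simpa using hb.le)⟩
  have hlow : Filter.Tendsto (fun n : ℕ => ENNReal.ofReal
      (1 - relVarBound k m (n / (k + m)) ((n : ℝ) ^ (-(1 / b))))) Filter.atTop (nhds 1) := by
    simpa using ENNReal.tendsto_ofReal ((tendsto_relVarBound m k hm hk hbk).const_sub 1)
  refine tendsto_of_tendsto_of_tendsto_of_le_of_le' hlow tendsto_const_nhds ?_ ?_
  · filter_upwards [Filter.eventually_ge_atTop (k + m)] with n hn
    obtain ⟨h₀, h₁⟩ := hp n (by omega)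
    have := isProbabilityMeasure_erdosRenyi n h₀.le h₁
    exact ENNReal.ofReal_le_of_le_toReal (one_sub_relVarBound_le m k n _
      (Nat.div_pos hn (by omega)) (Nat.mul_div_le n _) h₀ h₁)
  · filter_upwards [Filter.eventually_gt_atTop 0] with n hn
    have := isProbabilityMeasure_erdosRenyi n (hp n hn).1.le (hp n hn).2
    exact prob_le_one
end

section
/- Let X be a finite (k−1)-pure simplicial complex with vertex set X₀ of size x₀ and facet set F of size φ (every facet has exactly k vertices), and let m be an integer with m > k·x₀·φ. Let W : F → Finset(ℕ) assign to each facet f a set W(f) of size m, with (⋃_{f∈F} W(f)) ∩ X₀ = ∅, and set w₀ = |⋃_{f∈F} W(f)| and (XW)₀ = |⋃_{f∈F} (f × W(f))| (the number of edges in the union of the complete bipartite graphs f × W(f)). If the sets W(f), f ∈ F, are not pairwise disjoint, then (XW)₀/(x₀ + w₀) > k·m·φ/(x₀ + m·φ). (The right-hand side is the value b(x,r) obtained when the witness sets are pairwise disjoint.) -/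
/-- The facets (maximal faces) of a finite set system `X`. -/
def facets (X : Finset (Finset ℕ)) : Finset (Finset ℕ) :=
  X.filter fun s => ∀ t ∈ X, s ⊆ t → s = t

/-- The vertex set of a finite set system `X`. -/
def vertexSet (X : Finset (Finset ℕ)) : Finset ℕ := X.biUnion id

open Finset in
/-- The edges of a union of complete bipartite graphs `f × W f`, counted by their second ends. -/
theorem card_biUnion_product_eq_sum (F : Finset (Finset ℕ)) (W : Finset ℕ → Finset ℕ) :
    (F.biUnion fun f => f ×ˢ W f).card
      = ∑ v ∈ F.biUnion W, ((F.filter fun f => v ∈ W f).biUnion id).card := by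
  rw [card_eq_sum_card_fiberwise (f := Prod.snd) (t := F.biUnion W)]
  · refine sum_congr rfl fun v _ => ?_
    have h : ((F.biUnion fun f => f ×ˢ W f).filter fun p => p.2 = v)
        = ((F.filter fun f => v ∈ W f).biUnion id) ×ˢ {v} := by
      ext ⟨a, b⟩
      simp only [mem_filter, mem_biUnion, mem_product, mem_singleton, id]
      constructor
      · rintro ⟨⟨f, hf, ha, hb⟩, rfl⟩
        exact ⟨⟨f, ⟨hf, hb⟩, ha⟩, rfl⟩
      · rintro ⟨⟨f, ⟨hf, hb⟩, ha⟩, rfl⟩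
        exact ⟨⟨f, hf, ha, hb⟩, rfl⟩
    rw [h, card_product, card_singleton, mul_one]
  · rintro ⟨a, b⟩ h
    simp only [coe_biUnion, Set.mem_iUnion, mem_coe, mem_product] at h ⊢
    obtain ⟨f, hf, -, hb⟩ := h
    exact ⟨f, hf, hb⟩

open Finset in
/-- Double counting of the pairs `(f, v)` with `v ∈ W f`. -/
theorem sum_card_eq_sum_card_filter_mem (F : Finset (Finset ℕ)) (W : Finset ℕ → Finset ℕ) :
    ∑ f ∈ F, (W f).card = ∑ v ∈ F.biUnion W, (F.filter fun f => v ∈ W f).card := by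
  have h := sum_card_bipartiteAbove_eq_sum_card_bipartiteBelow
    (s := F) (t := F.biUnion W) (fun f v => v ∈ W f)
  rw [← show _ = ∑ v ∈ F.biUnion W, (F.filter fun f => v ∈ W f).card from h]
  refine sum_congr rfl fun f hf => congrArg card ?_
  ext v
  simp only [mem_bipartiteAbove, mem_biUnion]
  exact ⟨fun hv => ⟨⟨f, hf, hv⟩, hv⟩, fun hv => hv.2⟩

open Finset in
/-- In a nonempty uniform family the union exceeds the common size as soon as there are two
members. -/
theorem card_add_mul_le_of_uniform {k n : ℕ} {G : Finset (Finset ℕ)} (hne : G.Nonempty)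
    (hk : ∀ f ∈ G, f.card = k) (hn : G.card ≤ n) :
    G.card + n * k ≤ 1 + n * (G.biUnion id).card := by
  have hsub : ∀ f ∈ G, f ⊆ G.biUnion id := fun f hf => subset_biUnion_of_mem id hf
  obtain ⟨f, hf⟩ := hne
  have hle : k ≤ (G.biUnion id).card := hk f hf ▸ card_le_card (hsub f hf)
  rcases le_or_gt G.card 1 with h1 | h1
  · exact add_le_add h1 (Nat.mul_le_mul_left n hle)
  · have hlt : k + 1 ≤ (G.biUnion id).card := by
      by_contra hcon
      obtain ⟨a, ha, b, hb, hab⟩ := one_lt_card.mp h1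
      have heq : ∀ c ∈ G, c = G.biUnion id := fun c hc =>
        eq_of_subset_of_card_le (hsub c hc) (by have := hk c hc; omega)
      exact hab ((heq a ha).trans (heq b hb).symm)
    have := Nat.mul_le_mul_left n hlt
    rw [mul_add, mul_one] at this
    omega

/-- Lemma 3: for a finite $(k-1)$-pure simplicial complex $X$ with $\varphi$ facets and
$m > k x_0 \varphi$, any $m$-pure witness assignment $W$ whose witness sets are not
pairwise disjoint satisfies $b(x,w) > b(x,r)$, i.e. the edge density
$(XW)_0/(x_0+w_0)$ strictly exceeds $km\varphi/(x_0+m\varphi)$. -/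
theorem stmt16 (k m : ℕ) (X : Finset (Finset ℕ))
    (hdc : ∀ s ∈ X, ∀ t ⊆ s, t ∈ X)
    (hpure : ∀ f ∈ facets X, f.card = k)
    (hm : k * (vertexSet X).card * (facets X).card < m)
    (W : Finset ℕ → Finset ℕ)
    (hWm : ∀ f ∈ facets X, (W f).card = m)
    (hWdisj : (facets X).biUnion W ∩ vertexSet X = ∅)
    (hnd : ∃ f ∈ facets X, ∃ g ∈ facets X, f ≠ g ∧ (W f ∩ W g).Nonempty) :
    ((k : ℝ) * m * (facets X).card) / ((vertexSet X).card + m * (facets X).card)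
      < (((facets X).biUnion fun f => f ×ˢ W f).card : ℝ)
          / ((vertexSet X).card + ((facets X).biUnion W).card) := by
  have hN := card_biUnion_product_eq_sum (facets X) W
  have hS := sum_card_eq_sum_card_filter_mem (facets X) W
  rw [Finset.sum_congr rfl hWm, Finset.sum_const, smul_eq_mul] at hS
  have hne : ∀ v ∈ (facets X).biUnion W, ((facets X).filter fun f => v ∈ W f).Nonempty := by
    intro v hv
    obtain ⟨f, hf, hvf⟩ := Finset.mem_biUnion.mp hv
    exact ⟨f, Finset.mem_filter.mpr ⟨hf, hvf⟩⟩
  have hlt : ((facets X).biUnion W).card < (facets X).card * m := by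
    rw [hS, Finset.card_eq_sum_ones]
    obtain ⟨f, hf, g, hg, hfg, v, hv⟩ := hnd
    rw [Finset.mem_inter] at hv
    refine Finset.sum_lt_sum (fun v hv => Finset.card_pos.mpr (hne v hv))
      ⟨v, Finset.mem_biUnion.mpr ⟨f, hf, hv.1⟩, Finset.one_lt_card.mpr
        ⟨f, Finset.mem_filter.mpr ⟨hf, hv.1⟩, g, Finset.mem_filter.mpr ⟨hg, hv.2⟩, hfg⟩⟩
  have hsum : (facets X).card * m + ((facets X).biUnion W).card * ((facets X).card * k)
      ≤ ((facets X).biUnion W).card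
        + (facets X).card * ((facets X).biUnion fun f => f ×ˢ W f).card := by
    have h := Finset.sum_le_sum fun v hv => card_add_mul_le_of_uniform (hne v hv)
      (fun f hf => hpure f (Finset.mem_filter.mp hf).1)
      (Finset.card_le_card (Finset.filter_subset _ _))
    rw [Finset.sum_add_distrib, Finset.sum_add_distrib, ← hS, ← Finset.mul_sum, ← Finset.mul_sum,
      ← hN, Finset.sum_const, smul_eq_mul, ← Finset.card_eq_sum_ones, mul_left_comm] at h
    linarith
  have hφ : 0 < (facets X).card := by
    obtain ⟨f, hf, -⟩ := hnd
    exact Finset.card_pos.mpr ⟨f, hf⟩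
  have hwpos : 0 < ((facets X).biUnion W).card := by
    obtain ⟨f, hf, g, -, -, v, hv⟩ := hnd
    exact Finset.card_pos.mpr ⟨v, Finset.mem_biUnion.mpr ⟨f, hf, (Finset.mem_inter.mp hv).1⟩⟩
  generalize ((facets X).biUnion fun f => f ×ˢ W f).card = N at *
  generalize ((facets X).biUnion W).card = w at *
  generalize (facets X).card = φ at *
  generalize (vertexSet X).card = x at *
  have hm' : (k : ℝ) * x * φ < m := by exact_mod_cast hm
  have hlt' : (w : ℝ) < φ * m := by exact_mod_cast hlt
  have hsum' : (φ : ℝ) * m + w * (φ * k) ≤ w + φ * N := by exact_mod_cast hsum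
  have hφ' : (1 : ℝ) ≤ φ := by exact_mod_cast hφ
  have hx : (0 : ℝ) ≤ x := x.cast_nonneg
  have hk : (0 : ℝ) ≤ k := k.cast_nonneg
  have hm0 : (0 : ℝ) < m := lt_of_le_of_lt (by positivity) hm'
  have hwpos' : (0 : ℝ) < w := by exact_mod_cast hwpos
  rw [div_lt_div_iff₀ (by positivity) (by positivity)]
  have he : 0 < (N : ℝ) - k * w := by
    by_contra! hcon
    nlinarith
  have h1 : (k : ℝ) * x * (φ * m - w) ≤ k * x * (φ * (N - k * w)) :=
    mul_le_mul_of_nonneg_left (by linarith) (by positivity)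
  have h2 : (k : ℝ) * x * φ * (N - k * w) < m * (N - k * w) :=
    mul_lt_mul_of_pos_right hm' he
  have h3 : (m : ℝ) * (N - k * w) ≤ (φ * m) * (N - k * w) :=
    mul_le_mul_of_nonneg_right (by nlinarith) he.le
  have h4 : 0 ≤ (x : ℝ) * (N - k * w) := by positivity
  linarith
end

section
/- Let X be a finite simplicial complex with nonempty vertex set X₀ and facet set F containing at least one nonempty facet, and let m ≥ 1 be an integer. For a witness assignment W : F → Finset(ℕ) with |W(f)| = m for all f ∈ F and (⋃_{f∈F} W(f)) ∩ X₀ = ∅, let H(X,W) be the bipartite graph on vertex set X₀ ∪ (⋃_f W(f)) whose edges are all pairs {u,v} with u ∈ f and v ∈ W(f) for some facet f, and let d̄(H(X,W)) be the maximum over nonempty vertex subsets S of (number of edges of H(X,W) with both endpoints in S)/|S|. Define the m-density b_m(X) as the minimum of d̄(H(X,W)) over all such witness assignments W. Then b_m(X) is a threshold for the appearance of X in the m-neighbor complex of G(n, n^{−1/b}): if b > b_m(X), then as n → ∞ the probability under G(n, n^{−1/b}) that there exists an injection ρ : X₀ → [n] such that for every facet f of X the set ρ(f) has at least m common neighbors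 tends to 1; and if 0 < b < b_m(X), this probability tends to 0. -/
open MeasureTheory

/-- $W$ is an admissible $m$-witness assignment for the complex $X$: each facet gets a
witness set of size $m$, and the witness vertices are disjoint from the vertices of $X$. -/
def WitnessAdm (X : Finset (Finset ℕ)) (m : ℕ) (W : Finset ℕ → Finset ℕ) : Prop :=
  (∀ f ∈ facets X, (W f).card = m) ∧ (facets X).biUnion W ∩ vertexSet X = ∅

/-- The maximum subgraph density of the bipartite graph $H(X,W)$ whose edges join each
facet of $X$ to its witness set: the maximum over nonempty vertex subsets $S$ of the
number of edges inside $S$ divided by $|S|$. -/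
noncomputable def dbar (X : Finset (Finset ℕ)) (W : Finset ℕ → Finset ℕ) : ℝ :=
  sSup {r : ℝ | ∃ S : Finset ℕ, S.Nonempty ∧ S ⊆ vertexSet X ∪ (facets X).biUnion W ∧
    r = ((((facets X).biUnion fun f => f ×ˢ W f).filter
            fun e => e.1 ∈ S ∧ e.2 ∈ S).card : ℝ) / S.card}

/-- The $m$-density $b_m(X)$: the minimum of $\bar d(H(X,W))$ over admissible witness
assignments $W$. -/
noncomputable def mDensity (X : Finset (Finset ℕ)) (m : ℕ) : ℝ :=
  sInf {r : ℝ | ∃ W : Finset ℕ → Finset ℕ, WitnessAdm X m W ∧ r = dbar X W}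

/-- Edge configurations in which every edge of `E` is present. -/
def allPresent {n : ℕ} (E : Finset {e : Sym2 (Fin n) // ¬ e.IsDiag}) : Set (EdgeCfg n) :=
  {ω | ∀ e ∈ E, ω e = true}

theorem bern_isProbabilityMeasure {p : ℝ} (h0 : 0 ≤ p) (h1 : p ≤ 1) :
    IsProbabilityMeasure (bern p) := by
  constructor
  simp only [bern, Measure.coe_add, Measure.coe_smul, Pi.add_apply, Pi.smul_apply, measure_univ,
    smul_eq_mul, mul_one]
  rw [← ENNReal.ofReal_add h0 (by linarith)]
  simp

theorem erdosRenyi_isProbabilityMeasure (n : ℕ) {p : ℝ} (h0 : 0 ≤ p) (h1 : p ≤ 1) :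
    IsProbabilityMeasure (erdosRenyi n p) := by
  have := bern_isProbabilityMeasure h0 h1
  unfold erdosRenyi
  infer_instance

theorem erdosRenyi_real_allPresent {n : ℕ} {p : ℝ} (h0 : 0 ≤ p) (h1 : p ≤ 1)
    (E : Finset {e : Sym2 (Fin n) // ¬ e.IsDiag}) :
    (erdosRenyi n p).real (allPresent E) = p ^ E.card := by
  classical
  have := bern_isProbabilityMeasure h0 h1
  have hset : allPresent E = Set.univ.pi fun e => if e ∈ E then {true} else Set.univ := by
    ext ω
    simp only [allPresent, Set.mem_ofPred_eq, Set.mem_univ_pi]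
    refine forall_congr' fun e => ?_
    by_cases he : e ∈ E <;> simp [he]
  have hb : bern p {true} = ENNReal.ofReal p := by simp [bern]
  have hpow : erdosRenyi n p (allPresent E) = ENNReal.ofReal p ^ E.card := by
    rw [hset, erdosRenyi, Measure.pi_pi, ← Finset.prod_const, ← Finset.prod_subset E.subset_univ]
    · exact Finset.prod_congr rfl fun e he => by simp [he, hb]
    · intro e _ he
      simp only [he, if_false, measure_univ]
  rw [measureReal_def, hpow, ENNReal.toReal_pow, ENNReal.toReal_ofReal h0]

/-- The second moment inequality for a finite family of events on a finite space. -/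
theorem sq_sum_measureReal_le {Ω ι : Type*} [MeasurableSpace Ω] [Fintype Ω]
    [MeasurableSingletonClass Ω] [Fintype ι] (μ : Measure Ω) [IsFiniteMeasure μ]
    (A : ι → Set Ω) :
    (∑ i, μ.real (A i)) ^ 2 ≤ (∑ i, ∑ j, μ.real (A i ∩ A j)) * μ.real (⋃ i, A i) := by
  classical
  have key (B : Set Ω) : μ.real B = ∑ ω, μ.real {ω} * B.indicator 1 ω := by
    have h := sum_measureReal_singleton (μ := μ) (Finset.univ.filter (· ∈ B))
    rw [Finset.sum_filter] at h
    simp only [Finset.coe_filter, Finset.mem_univ, true_and, Set.ofPred_mem_eq] at h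
    rw [← h]
    refine Finset.sum_congr rfl fun ω _ => ?_
    by_cases hω : ω ∈ B <;> simp [hω]
  set N : Ω → ℝ := fun ω => ∑ i, (A i).indicator 1 ω with hN
  have h1 : ∑ i, μ.real (A i) = ∑ ω, μ.real {ω} * N ω := by
    simp_rw [key (A _), hN, Finset.mul_sum]
    exact Finset.sum_comm
  have h2 : ∑ i, ∑ j, μ.real (A i ∩ A j) = ∑ ω, μ.real {ω} * N ω ^ 2 := by
    simp_rw [key (A _ ∩ A _), hN, sq, Finset.sum_mul_sum, Finset.mul_sum,
      Set.inter_indicator_one, Pi.mul_apply]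
    rw [Finset.sum_comm]
    simp_rw [Finset.sum_comm (s := (Finset.univ : Finset ι)) (t := (Finset.univ : Finset Ω))]
    refine Finset.sum_congr rfl fun ω _ => ?_
    rw [Finset.sum_comm]
  rw [h1, h2, key (⋃ i, A i)]
  refine Finset.sum_sq_le_sum_mul_sum_of_sq_le_mul _ (fun ω _ => by positivity)
    (fun ω _ => mul_nonneg measureReal_nonneg (Set.indicator_nonneg (by simp) _))
    fun ω _ => le_of_eq ?_
  by_cases hω : ω ∈ ⋃ i, A i
  · simp only [Set.indicator_of_mem hω, Pi.one_apply]
    ring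
  · have : N ω = 0 := Finset.sum_eq_zero fun i _ =>
      Set.indicator_of_notMem (fun h => hω (Set.mem_iUnion_of_mem i h)) _
    simp [this]

/-- The edge joining two distinct vertices. -/
def edge {n : ℕ} (u v : Fin n) (h : u ≠ v) : {e : Sym2 (Fin n) // ¬ e.IsDiag} :=
  ⟨s(u, v), by simpa [Sym2.mk_isDiag_iff] using h⟩

/-- Second moment bound for the block copies of a bipartite graph `E`: in the union of `|V|`
blocks of size `N`, the vertex `v` of the pattern may only go to the block of `v`. -/
theorem one_le_mul_measureReal_copies {V : Type*} [Fintype V] [DecidableEq V]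
    (E : Finset (V × V)) (hE : ∀ e ∈ E, ∀ e' ∈ E, e.1 ≠ e'.2) {n N : ℕ} (hN : 0 < N)
    (hn : Fintype.card V * N ≤ n) {p : ℝ} (h0 : 0 < p) (h1 : p ≤ 1) :
    1 ≤ (∑ S : Finset V, ((N : ℝ) ^ S.card)⁻¹ *
          (p ^ (E.filter fun e => e.1 ∈ S ∧ e.2 ∈ S).card)⁻¹) *
      (erdosRenyi n p).real {ω | ∃ g : V → Fin n, Function.Injective g ∧
        ∀ e ∈ E, Adj ω (g e.1) (g e.2)} := by
  classical
  have := erdosRenyi_isProbabilityMeasure n h0.le h1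
  obtain ⟨ι⟩ : Nonempty (V × Fin N ↪ Fin n) :=
    Function.Embedding.nonempty_of_card_le (by simpa using hn)
  have hne (φ : V → Fin N) (e : E) : ι (e.1.1, φ e.1.1) ≠ ι (e.1.2, φ e.1.2) := fun h =>
    hE _ e.2 _ e.2 (congrArg Prod.fst (ι.injective h))
  let ed (φ : V → Fin N) (e : E) := edge _ _ (hne φ e)
  have hed {φ ψ : V → Fin N} {e e' : E} (h : ed φ e = ed ψ e') :
      e = e' ∧ φ e.1.1 = ψ e.1.1 ∧ φ e.1.2 = ψ e.1.2 := by
    have h := congrArg Subtype.val h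
    simp only [ed, edge, Sym2.eq_iff, ι.injective.eq_iff, Prod.mk.injEq] at h
    rcases h with ⟨⟨h1, h2⟩, h3, h4⟩ | ⟨⟨h1, -⟩, -⟩
    · have : e = e' := Subtype.ext (Prod.ext h1 h3)
      subst this
      exact ⟨rfl, h2, h4⟩
    · exact absurd h1 (hE _ e.2 _ e'.2)
  let Ed (φ : V → Fin N) := Finset.univ.image (ed φ)
  have hcard (φ) : (Ed φ).card = E.card := by
    rw [Finset.card_image_of_injective _ fun e e' h => (hed h).1]
    simp
  let c (S : Finset V) := (E.filter fun e => e.1 ∈ S ∧ e.2 ∈ S).card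
  let eqs (φ ψ : V → Fin N) := Finset.univ.filter fun v => φ v = ψ v
  have hinter (φ ψ) : (Ed φ ∩ Ed ψ).card ≤ c (eqs φ ψ) := by
    have hsub : Ed φ ∩ Ed ψ ⊆
        (Finset.univ.filter fun e : E => e.1.1 ∈ eqs φ ψ ∧ e.1.2 ∈ eqs φ ψ).image (ed φ) := by
      intro x hx
      simp only [Ed, Finset.mem_inter, Finset.mem_image, Finset.mem_univ, true_and] at hx
      obtain ⟨⟨e, rfl⟩, e', he'⟩ := hx
      obtain ⟨rfl, h2⟩ := hed he'
      exact Finset.mem_image_of_mem _ (by simp [eqs, h2.1, h2.2])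
    refine (Finset.card_le_card hsub).trans (Finset.card_image_le.trans ?_)
    refine Finset.card_le_card_of_injOn Subtype.val (fun e he => ?_) Subtype.val_injective.injOn
    simpa using he
  have hpair (φ ψ) : (erdosRenyi n p).real (allPresent (Ed φ) ∩ allPresent (Ed ψ)) ≤
      p ^ (2 * E.card) * (p ^ c (eqs φ ψ))⁻¹ := by
    have : allPresent (Ed φ) ∩ allPresent (Ed ψ) = allPresent (Ed φ ∪ Ed ψ) := by
      ext ω
      simp only [allPresent, Set.mem_inter_iff, Set.mem_ofPred_eq, Finset.mem_union, or_imp,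
        forall_and]
    rw [this, erdosRenyi_real_allPresent h0.le h1, ← div_eq_mul_inv, le_div_iff₀ (by positivity),
      ← pow_add]
    refine pow_le_pow_of_le_one h0.le h1 ?_
    have := Finset.card_union_add_card_inter (Ed φ) (Ed ψ)
    have := hinter φ ψ
    rw [hcard, hcard] at *
    omega
  have hcount (S : Finset V) : ((Finset.univ.filter fun x : (V → Fin N) × (V → Fin N) =>
      eqs x.1 x.2 = S).card : ℝ) ≤ (N : ℝ) ^ (2 * Fintype.card V) * ((N : ℝ) ^ S.card)⁻¹ := by
    have hle : (Finset.univ.filter fun x : (V → Fin N) × (V → Fin N) => eqs x.1 x.2 = S).card ≤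
        Fintype.card ((V → Fin N) × ((Sᶜ : Finset V) → Fin N)) := by
      refine Finset.card_le_card_of_injOn (fun x => (x.1, fun v => x.2 v)) (by simp) ?_
      rintro ⟨φ, ψ⟩ hx ⟨φ', ψ'⟩ hx' h
      simp only [Finset.coe_filter, Finset.mem_univ, true_and, Set.mem_ofPred_eq] at hx hx'
      simp only [Prod.mk.injEq] at h
      obtain ⟨rfl, h⟩ := h
      refine Prod.ext rfl (funext fun v => ?_)
      by_cases hv : v ∈ S
      · have h1 : φ v = ψ v := by simpa [eqs] using hx.symm.subset hv
        have h2 : φ v = ψ' v := by simpa [eqs] using hx'.symm.subset hv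
        exact h1.symm.trans h2
      · exact congrFun h ⟨v, by simpa using hv⟩
    rw [← div_eq_mul_inv, le_div_iff₀ (by positivity)]
    have hc := S.card_add_card_compl
    calc _ ≤ ((N ^ Fintype.card V * N ^ (Sᶜ).card : ℕ) : ℝ) * (N : ℝ) ^ S.card := by
          gcongr
          simpa only [Fintype.card_prod, Fintype.card_fun, Fintype.card_fin, Fintype.card_coe]
            using hle
      _ = _ := by
          push_cast
          rw [← pow_add, ← pow_add]
          congr 1
          omega
  have hsecond : ∑ φ, ∑ ψ, (erdosRenyi n p).real (allPresent (Ed φ) ∩ allPresent (Ed ψ)) ≤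
      (N : ℝ) ^ (2 * Fintype.card V) * p ^ (2 * E.card) *
        ∑ S : Finset V, ((N : ℝ) ^ S.card)⁻¹ * (p ^ c S)⁻¹ := by
    calc _ ≤ ∑ φ, ∑ ψ, p ^ (2 * E.card) * (p ^ c (eqs φ ψ))⁻¹ :=
          Finset.sum_le_sum fun φ _ => Finset.sum_le_sum fun ψ _ => hpair φ ψ
      _ = ∑ x : (V → Fin N) × (V → Fin N), p ^ (2 * E.card) * (p ^ c (eqs x.1 x.2))⁻¹ :=
          (Fintype.sum_prod_type' fun φ ψ => p ^ (2 * E.card) * (p ^ c (eqs φ ψ))⁻¹).symm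
      _ = ∑ S : Finset V, ∑ x : (V → Fin N) × (V → Fin N) with eqs x.1 x.2 = S,
            p ^ (2 * E.card) * (p ^ c (eqs x.1 x.2))⁻¹ :=
          (Finset.sum_fiberwise _ _ _).symm
      _ = ∑ S : Finset V, ((Finset.univ.filter fun x : (V → Fin N) × (V → Fin N) =>
            eqs x.1 x.2 = S).card : ℝ) * (p ^ (2 * E.card) * (p ^ c S)⁻¹) := by
          refine Finset.sum_congr rfl fun S _ => ?_
          rw [← nsmul_eq_mul, ← Finset.sum_const]
          refine Finset.sum_congr rfl fun x hx => ?_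
          rw [(Finset.mem_filter.1 hx).2]
      _ ≤ ∑ S : Finset V, ((N : ℝ) ^ (2 * Fintype.card V) * ((N : ℝ) ^ S.card)⁻¹) *
            (p ^ (2 * E.card) * (p ^ c S)⁻¹) := by
          gcongr with S
          exact hcount S
      _ = _ := by
          rw [Finset.mul_sum]
          exact Finset.sum_congr rfl fun S _ => by ring
  have hfirst : ∑ φ, (erdosRenyi n p).real (allPresent (Ed φ)) =
      (N : ℝ) ^ Fintype.card V * p ^ E.card := by
    simp [erdosRenyi_real_allPresent h0.le h1, hcard]
  have hunion : (⋃ φ, allPresent (Ed φ)) ⊆ {ω | ∃ g : V → Fin n, Function.Injective g ∧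
      ∀ e ∈ E, Adj ω (g e.1) (g e.2)} := by
    intro ω hω
    obtain ⟨φ, hφ⟩ := Set.mem_iUnion.1 hω
    refine ⟨fun v => ι (v, φ v), fun u v h => congrArg Prod.fst (ι.injective h), fun e he => ?_⟩
    exact ⟨hne φ ⟨e, he⟩, hφ _ (Finset.mem_image.2 ⟨⟨e, he⟩, Finset.mem_univ _, rfl⟩)⟩
  have hpos : 0 < (N : ℝ) ^ (2 * Fintype.card V) * p ^ (2 * E.card) := by positivity
  have h := (sq_sum_measureReal_le (erdosRenyi n p) fun φ => allPresent (Ed φ)).trans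
    (mul_le_mul hsecond (measureReal_mono hunion) measureReal_nonneg (by positivity))
  rw [hfirst] at h
  refine le_of_mul_le_mul_left ?_ hpos
  calc _ = ((N : ℝ) ^ Fintype.card V * p ^ E.card) ^ 2 := by ring
    _ ≤ _ := h
    _ = _ := by ring

/-- The edges of the graph encoded by `ω` with both endpoints in `T`. -/
noncomputable def edgesIn {n : ℕ} (ω : EdgeCfg n) (T : Finset (Fin n)) :
    Finset {e : Sym2 (Fin n) // ¬ e.IsDiag} :=
  Finset.univ.filter fun e => ω e = true ∧ ∀ v ∈ e.1, v ∈ T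

open Classical in
/-- The ordered adjacent pairs in `A × B`. -/
noncomputable def adjPairs {n : ℕ} (ω : EdgeCfg n) (A B : Finset (Fin n)) :
    Finset (Fin n × Fin n) :=
  (A ×ˢ B).filter fun x => Adj ω x.1 x.2

theorem Adj.symm {n : ℕ} {ω : EdgeCfg n} {u v : Fin n} (h : Adj ω u v) : Adj ω v u := by
  obtain ⟨h1, h2⟩ := h
  refine ⟨h1.symm, ?_⟩
  rw [← h2]
  congr 1
  exact Subtype.ext Sym2.eq_swap

theorem card_adjPairs_self_le {n : ℕ} (ω : EdgeCfg n) (T : Finset (Fin n)) :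
    (adjPairs ω T T).card ≤ 2 * (edgesIn ω T).card := by
  classical
  have hmem {x : Fin n × Fin n} (hx : x ∈ adjPairs ω T T) :
      x.1 ≠ x.2 ∧ x.1 ∈ T ∧ x.2 ∈ T ∧ Adj ω x.1 x.2 := by
    simp only [adjPairs, Finset.mem_filter, Finset.mem_product] at hx
    exact ⟨hx.2.1, hx.1.1, hx.1.2, hx.2⟩
  have h : (adjPairs ω T T).attach.card ≤
      (edgesIn ω T ×ˢ (Finset.univ : Finset Bool)).card := by
    refine Finset.card_le_card_of_injOn
      (fun x => (edge x.1.1 x.1.2 (hmem x.2).1, decide (x.1.1 < x.1.2))) (fun x _ => ?_) ?_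
    · obtain ⟨-, h1, h2, h3, h4⟩ := hmem x.2
      simpa [edgesIn, edge, h1, h2, lt_or_ge] using h4
    · rintro ⟨⟨a, b⟩, hx⟩ - ⟨⟨c, d⟩, hy⟩ - h
      have h1 := (hmem hx).1
      simp only [edge, Prod.mk.injEq, Subtype.mk.injEq, Sym2.eq_iff, decide_eq_decide] at h h1
      obtain ⟨⟨rfl, rfl⟩ | ⟨rfl, rfl⟩, h⟩ := h
      · rfl
      · exact absurd h (by omega)
  simpa [mul_comm] using h

/-- Passing to the bipartite double cover does not increase the number of edges beyond those of
`A ∪ B` and `A ∩ B` together. -/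
theorem card_adjPairs_le {n : ℕ} (ω : EdgeCfg n) (A B : Finset (Fin n)) :
    (adjPairs ω A B).card ≤ (edgesIn ω (A ∪ B)).card + (edgesIn ω (A ∩ B)).card := by
  classical
  have hswap : (adjPairs ω B A).card = (adjPairs ω A B).card := by
    refine Finset.card_nbij' Prod.swap Prod.swap ?_ ?_ (fun _ _ => rfl) fun _ _ => rfl <;>
    · intro x hx
      simp only [adjPairs, Finset.coe_filter, Finset.mem_product, Set.mem_ofPred_eq,
        Prod.fst_swap, Prod.snd_swap] at hx ⊢
      exact ⟨hx.1.symm, hx.2.symm⟩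
  have h := Finset.card_union_add_card_inter (adjPairs ω A B) (adjPairs ω B A)
  have hU : adjPairs ω A B ∪ adjPairs ω B A ⊆ adjPairs ω (A ∪ B) (A ∪ B) := by
    intro x hx
    simp only [adjPairs, Finset.mem_union, Finset.mem_filter, Finset.mem_product] at hx ⊢
    tauto
  have hI : adjPairs ω A B ∩ adjPairs ω B A ⊆ adjPairs ω (A ∩ B) (A ∩ B) := by
    intro x hx
    simp only [adjPairs, Finset.mem_inter, Finset.mem_filter, Finset.mem_product] at hx ⊢
    tauto
  have := Finset.card_le_card hU
  have := Finset.card_le_card hI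
  have := card_adjPairs_self_le ω (A ∪ B)
  have := card_adjPairs_self_le ω (A ∩ B)
  omega

theorem dbar_nonneg (X : Finset (Finset ℕ)) (W : Finset ℕ → Finset ℕ) : 0 ≤ dbar X W := by
  refine Real.sSup_nonneg ?_
  rintro r ⟨S, -, -, rfl⟩
  positivity

theorem mDensity_nonneg (X : Finset (Finset ℕ)) (m : ℕ) : 0 ≤ mDensity X m := by
  refine Real.sInf_nonneg ?_
  rintro r ⟨W, -, rfl⟩
  exact dbar_nonneg X W

theorem mDensity_le_dbar {X : Finset (Finset ℕ)} {m : ℕ} {W : Finset ℕ → Finset ℕ}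
    (hW : WitnessAdm X m W) : mDensity X m ≤ dbar X W := by
  refine csInf_le ⟨0, ?_⟩ ⟨W, hW, rfl⟩
  rintro r ⟨W, -, rfl⟩
  exact dbar_nonneg X W

/-- The set of densities whose supremum is `dbar` is finite. -/
theorem finite_densities (X : Finset (Finset ℕ)) (W : Finset ℕ → Finset ℕ) :
    {r : ℝ | ∃ S : Finset ℕ, S.Nonempty ∧ S ⊆ vertexSet X ∪ (facets X).biUnion W ∧
    r = ((((facets X).biUnion fun f => f ×ˢ W f).filter
            fun e => e.1 ∈ S ∧ e.2 ∈ S).card : ℝ) / S.card}.Finite := by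
  refine ((vertexSet X ∪ (facets X).biUnion W).powerset.finite_toSet.image fun S =>
    ((((facets X).biUnion fun f => f ×ˢ W f).filter
      fun e => e.1 ∈ S ∧ e.2 ∈ S).card : ℝ) / S.card).subset ?_
  rintro r ⟨S, -, hS, rfl⟩
  exact ⟨S, Finset.mem_coe.2 (Finset.mem_powerset.2 hS), rfl⟩

theorem card_filter_le_dbar_mul {X : Finset (Finset ℕ)} {W : Finset ℕ → Finset ℕ} {S : Finset ℕ}
    (hS : S.Nonempty) (hsub : S ⊆ vertexSet X ∪ (facets X).biUnion W) :
    ((((facets X).biUnion fun f => f ×ˢ W f).filter fun e => e.1 ∈ S ∧ e.2 ∈ S).card : ℝ) ≤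
      dbar X W * S.card := by
  rw [← div_le_iff₀ (by exact_mod_cast hS.card_pos)]
  exact le_csSup (finite_densities X W).bddAbove ⟨S, hS, hsub, rfl⟩

theorem exists_dbar_mul_eq {X : Finset (Finset ℕ)} (hne : (vertexSet X).Nonempty)
    (W : Finset ℕ → Finset ℕ) :
    ∃ S : Finset ℕ, S.Nonempty ∧ S ⊆ vertexSet X ∪ (facets X).biUnion W ∧
      dbar X W * S.card = ((((facets X).biUnion fun f => f ×ˢ W f).filter
        fun e => e.1 ∈ S ∧ e.2 ∈ S).card : ℝ) := by
  obtain ⟨S, hS, hsub, h⟩ := Set.Nonempty.csSup_mem (by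
    exact ⟨_, vertexSet X, hne, Finset.subset_union_left, rfl⟩) (finite_densities X W)
  refine ⟨S, hS, hsub, ?_⟩
  rw [dbar, h, div_mul_cancel₀]
  exact_mod_cast hS.card_pos.ne'

theorem mem_vertexSet {X : Finset (Finset ℕ)} {f : Finset ℕ} (hf : f ∈ facets X) {u : ℕ}
    (hu : u ∈ f) : u ∈ vertexSet X :=
  Finset.mem_biUnion.2 ⟨f, (Finset.mem_filter.1 hf).1, hu⟩

/-- A copy of `X` in the `m`-neighbor complex forces a bounded subgraph of density at least the
`m`-density, even if common neighbors of one facet are used as vertices of others. -/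
theorem exists_dense_of_copy {X : Finset (Finset ℕ)} (hne : (vertexSet X).Nonempty) {m n : ℕ}
    {ω : EdgeCfg n} {ρ : ℕ → Fin n} (hρ : Set.InjOn ρ (vertexSet X : Set ℕ))
    (hface : ∀ f ∈ facets X, IsFace ω m (f.image ρ)) :
    ∃ T : Finset (Fin n), T.Nonempty ∧ T.card ≤ (vertexSet X).card + (facets X).card * m ∧
      mDensity X m * T.card ≤ (edgesIn ω T).card := by
  classical
  choose! Y hY hYcard using fun f hf => Finset.exists_subset_card_eq (hface f hf)
  obtain ⟨M, hM⟩ : ∃ M, ∀ u ∈ vertexSet X, u < M :=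
    ⟨(vertexSet X).sup id + 1, fun u hu => Nat.lt_succ_of_le (Finset.le_sup (f := id) hu)⟩
  have hshift : Function.Injective fun v : Fin n => v.1 + M := fun a b h =>
    Fin.ext (Nat.add_right_cancel h)
  let W : Finset ℕ → Finset ℕ := fun f => (Y f).image fun v => v.1 + M
  have hW : WitnessAdm X m W := by
    refine ⟨fun f hf => ?_, ?_⟩
    · rw [Finset.card_image_of_injective _ hshift, hYcard f hf]
    · ext w
      simp only [Finset.mem_inter, Finset.mem_biUnion, Finset.notMem_empty, iff_false, not_and]
      rintro ⟨f, -, hw⟩ hw'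
      obtain ⟨v, -, rfl⟩ := Finset.mem_image.1 hw
      have := hM _ hw'
      omega
  obtain ⟨S, hS, hsub, hSd⟩ := exists_dbar_mul_eq hne W
  have hSge : mDensity X m * S.card ≤ _ :=
    (mul_le_mul_of_nonneg_right (mDensity_le_dbar hW) (Nat.cast_nonneg _)).trans_eq hSd
  have hScard : S.card ≤ (vertexSet X).card + (facets X).card * m :=
    (Finset.card_le_card hsub).trans <| (Finset.card_union_le _ _).trans <|
      Nat.add_le_add_left (Finset.card_biUnion_le_card_mul _ _ _ fun f hf => (hW.1 f hf).le) _
  let A : Finset (Fin n) := (S.filter (· ∈ vertexSet X)).image ρ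
  let B : Finset (Fin n) := Finset.univ.filter fun v => v.1 + M ∈ S
  have hAB : A.card + B.card = S.card := by
    have hA : A.card = (S.filter (· ∈ vertexSet X)).card :=
      Finset.card_image_of_injOn <| hρ.mono fun u hu => by
        simpa using (Finset.mem_filter.1 hu).2
    have hB : B.card = (S.filter (· ∉ vertexSet X)).card := by
      rw [← Finset.card_image_of_injective B hshift]
      congr 1
      ext w
      simp only [B, Finset.mem_image, Finset.mem_filter, Finset.mem_univ, true_and]
      constructor
      · rintro ⟨v, hv, rfl⟩
        exact ⟨hv, fun h => by have := hM _ h; omega⟩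
      · rintro ⟨hw, hw'⟩
        obtain ⟨f, -, hwf⟩ := Finset.mem_biUnion.1
          ((Finset.mem_union.1 (hsub hw)).resolve_left hw')
        obtain ⟨v, -, rfl⟩ := Finset.mem_image.1 hwf
        exact ⟨v, hw, rfl⟩
    rw [hA, hB, Finset.card_filter_add_card_filter_not]
  have hedges : (((facets X).biUnion fun f => f ×ˢ W f).filter
      fun e => e.1 ∈ S ∧ e.2 ∈ S).card ≤ (adjPairs ω A B).card := by
    rw [← Finset.card_image_of_injective (adjPairs ω A B)
      (Function.injective_id.prodMap hshift)]
    refine Finset.card_le_card_of_injOn (fun e => (ρ e.1, e.2)) (fun e he => ?_) ?_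
    · simp only [Finset.coe_filter, Finset.mem_biUnion, Finset.mem_product, Set.mem_ofPred_eq]
        at he
      obtain ⟨⟨f, hf, he1, he2⟩, hS1, hS2⟩ := he
      obtain ⟨v, hv, hve⟩ := Finset.mem_image.1 he2
      have hnb := hY f hf hv
      simp only [commonNbrs, Finset.mem_filter, Finset.mem_univ, true_and] at hnb
      refine Finset.mem_coe.2 (Finset.mem_image.2 ⟨(ρ e.1, v), ?_, by simp [← hve]⟩)
      simp only [adjPairs, Finset.mem_filter, Finset.mem_product]
      exact ⟨⟨Finset.mem_image_of_mem _ (Finset.mem_filter.2 ⟨hS1, mem_vertexSet hf he1⟩),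
        by simpa [B, hve] using hS2⟩, (hnb.2 _ (Finset.mem_image_of_mem _ he1)).symm⟩
    · rintro ⟨u, w⟩ he ⟨u', w'⟩ he' h
      simp only [Finset.coe_filter, Finset.mem_biUnion, Finset.mem_product, Set.mem_ofPred_eq]
        at he he'
      obtain ⟨⟨f, hf, he1, -⟩, -⟩ := he
      obtain ⟨⟨f', hf', he1', -⟩, -⟩ := he'
      simp only [Prod.mk.injEq] at h
      exact Prod.ext (hρ (mem_vertexSet hf he1) (mem_vertexSet hf' he1') h.1) h.2
  have hadj := card_adjPairs_le ω A B
  have hui := Finset.card_union_add_card_inter A B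
  have hUpos : (A ∪ B).Nonempty := by
    rw [← Finset.card_pos]
    have := hS.card_pos
    have := Finset.card_le_card (Finset.inter_subset_union (s := A) (t := B))
    omega
  by_cases hU : mDensity X m * (A ∪ B).card ≤ (edgesIn ω (A ∪ B)).card
  · exact ⟨A ∪ B, hUpos, by omega, hU⟩
  have hI : mDensity X m * (A ∩ B).card < (edgesIn ω (A ∩ B)).card := by
    have h1 : (((((facets X).biUnion fun f => f ×ˢ W f).filter
        fun e => e.1 ∈ S ∧ e.2 ∈ S).card : ℕ) : ℝ) ≤
          (edgesIn ω (A ∪ B)).card + (edgesIn ω (A ∩ B)).card := by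
      exact_mod_cast hedges.trans hadj
    have h2 : (S.card : ℝ) = (A ∪ B).card + (A ∩ B).card := by
      exact_mod_cast (hui.trans hAB).symm
    rw [h2] at hSge
    linarith
  refine ⟨A ∩ B, ?_, by omega, hI.le⟩
  by_contra hemp
  rw [Finset.not_nonempty_iff_eq_empty] at hemp
  have hz : edgesIn ω (A ∩ B) = ∅ := by
    refine Finset.filter_eq_empty_iff.2 ?_
    rintro ⟨e, he⟩ - ⟨-, h⟩
    induction e with
    | h x y => simpa [hemp] using h x (Sym2.mem_mk_left x y)
  rw [hz, hemp] at hI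
  simp at hI

/-- First moment bound for the appearance of a dense subgraph on at most `K` vertices. -/
theorem erdosRenyi_real_dense_le (n K : ℕ) (β : ℝ) {p : ℝ} (h0 : 0 < p) (h1 : p ≤ 1) :
    (erdosRenyi n p).real {ω | ∃ T : Finset (Fin n), T.Nonempty ∧ T.card ≤ K ∧
      β * T.card ≤ (edgesIn ω T).card} ≤
    ∑ t ∈ Finset.Icc 1 K, (2 : ℝ) ^ (t + 1).choose 2 * ((n : ℝ) ^ t * p ^ (β * t)) := by
  classical
  have := erdosRenyi_isProbabilityMeasure n h0.le h1
  let Q (T : Finset (Fin n)) : Finset {e : Sym2 (Fin n) // ¬ e.IsDiag} :=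
    Finset.univ.filter fun e => ∀ v ∈ e.1, v ∈ T
  let P (t : ℕ) (T : Finset (Fin n)) := (Q T).powerset.filter fun D => β * t ≤ D.card
  have hsub : {ω | ∃ T : Finset (Fin n), T.Nonempty ∧ T.card ≤ K ∧
      β * T.card ≤ (edgesIn ω T).card} ⊆
      ⋃ t ∈ Finset.Icc 1 K, ⋃ T ∈ Finset.powersetCard t (Finset.univ : Finset (Fin n)),
        ⋃ D ∈ P t T, allPresent D := by
    rintro ω ⟨T, hT, hTK, hd⟩
    simp only [Set.mem_iUnion]
    refine ⟨T.card, Finset.mem_Icc.2 ⟨hT.card_pos, hTK⟩, T,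
      Finset.mem_powersetCard_univ.2 rfl, edgesIn ω T, ?_,
      fun e he => (Finset.mem_filter.1 he).2.1⟩
    refine Finset.mem_filter.2 ⟨Finset.mem_powerset.2 fun e he => ?_, hd⟩
    exact Finset.mem_filter.2 ⟨Finset.mem_univ _, (Finset.mem_filter.1 he).2.2⟩
  have hQ (T : Finset (Fin n)) : (Q T).card ≤ (T.card + 1).choose 2 := by
    rw [← Finset.card_sym2]
    exact Finset.card_le_card_of_injOn Subtype.val
      (fun e he => Finset.mem_coe.2 (Finset.mem_sym2_iff.2 (Finset.mem_filter.1 he).2))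
      Subtype.val_injective.injOn
  refine (measureReal_mono hsub (measure_ne_top _ _)).trans <|
    (measureReal_biUnion_finset_le _ _).trans <|
    Finset.sum_le_sum fun t _ => (measureReal_biUnion_finset_le _ _).trans ?_
  calc _ ≤ ∑ T ∈ Finset.powersetCard t (Finset.univ : Finset (Fin n)),
        (2 : ℝ) ^ (t + 1).choose 2 * p ^ (β * t) := by
        refine Finset.sum_le_sum fun T hT => (measureReal_biUnion_finset_le _ _).trans ?_
        rw [Finset.mem_powersetCard_univ] at hT
        calc _ ≤ ∑ D ∈ P t T, p ^ (β * t) := by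
              refine Finset.sum_le_sum fun D hD => ?_
              rw [erdosRenyi_real_allPresent h0.le h1, ← Real.rpow_natCast]
              exact Real.rpow_le_rpow_of_exponent_ge h0 h1 (Finset.mem_filter.1 hD).2
          _ = ((P t T).card : ℝ) * p ^ (β * t) := by rw [Finset.sum_const, nsmul_eq_mul]
          _ ≤ _ := by
              gcongr
              have : (P t T).card ≤ 2 ^ (t + 1).choose 2 := by
                refine (Finset.card_filter_le _ _).trans ?_
                rw [Finset.card_powerset]
                exact Nat.pow_le_pow_right two_pos (hT ▸ hQ T)
              exact_mod_cast this
    _ = ((n.choose t : ℕ) : ℝ) * ((2 : ℝ) ^ (t + 1).choose 2 * p ^ (β * t)) := by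
        simp
    _ ≤ (n : ℝ) ^ t * ((2 : ℝ) ^ (t + 1).choose 2 * p ^ (β * t)) := by
        gcongr
        exact_mod_cast Nat.choose_le_pow n t
    _ = _ := by ring

theorem tendsto_natCast_rpow_neg {a : ℝ} (ha : 0 < a) :
    Filter.Tendsto (fun n : ℕ => (n : ℝ) ^ (-a)) Filter.atTop (nhds 0) :=
  (tendsto_rpow_neg_atTop ha).comp tendsto_natCast_atTop_atTop

theorem natCast_rpow_mem_Ioc {n : ℕ} (hn : 1 ≤ n) {b : ℝ} (hb : 0 < b) :
    0 < (n : ℝ) ^ (-(1/b)) ∧ (n : ℝ) ^ (-(1/b)) ≤ 1 := by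
  have : (1 : ℝ) ≤ n := by exact_mod_cast hn
  exact ⟨by positivity, Real.rpow_le_one_of_one_le_of_nonpos this (by simpa using hb.le)⟩

/-- Dense subgraphs of bounded size do not appear below their threshold. -/
theorem tendsto_erdosRenyi_dense (K : ℕ) {β b : ℝ} (hb : 0 < b) (hβ : b < β) :
    Filter.Tendsto (fun n : ℕ => (erdosRenyi n ((n : ℝ) ^ (-(1/b)))).real
      {ω | ∃ T : Finset (Fin n), T.Nonempty ∧ T.card ≤ K ∧
        β * T.card ≤ (edgesIn ω T).card}) Filter.atTop (nhds 0) := by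
  have hlim : Filter.Tendsto (fun n : ℕ => ∑ t ∈ Finset.Icc 1 K, (2 : ℝ) ^ (t + 1).choose 2 *
      ((n : ℝ) ^ t * ((n : ℝ) ^ (-(1/b))) ^ (β * t))) Filter.atTop (nhds 0) := by
    suffices h : ∀ t ∈ Finset.Icc 1 K, Filter.Tendsto (fun n : ℕ => (2 : ℝ) ^ (t + 1).choose 2 *
        ((n : ℝ) ^ t * ((n : ℝ) ^ (-(1/b))) ^ (β * t))) Filter.atTop (nhds 0) by
      simpa only [Finset.sum_const_zero] using tendsto_finsetSum _ h
    intro t ht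
    have ht : (0 : ℝ) < t := by exact_mod_cast (Finset.mem_Icc.1 ht).1
    have ha : 0 < (β / b - 1) * t := mul_pos (sub_pos.2 ((one_lt_div hb).2 hβ)) ht
    rw [← mul_zero ((2 : ℝ) ^ (t + 1).choose 2)]
    refine ((tendsto_natCast_rpow_neg ha).congr' ?_).const_mul _
    filter_upwards [Filter.eventually_ge_atTop 1] with n hn
    have hn : (0 : ℝ) < n := by exact_mod_cast hn
    rw [← Real.rpow_natCast, ← Real.rpow_mul hn.le, ← Real.rpow_add hn]
    congr 1
    field_simp
    ring
  refine squeeze_zero' (Filter.Eventually.of_forall fun n => measureReal_nonneg) ?_ hlim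
  filter_upwards [Filter.eventually_ge_atTop 1] with n hn
  obtain ⟨h0, h1⟩ := natCast_rpow_mem_Ioc hn hb
  exact erdosRenyi_real_dense_le n K β h0 h1

theorem tendsto_inv_blockSize_pow_mul (k : ℕ) (hk : 0 < k) {s c : ℕ} {b : ℝ} (hb : 0 < b)
    (hc : (c : ℝ) < b * s) :
    Filter.Tendsto (fun n : ℕ => (((n / k : ℕ) : ℝ) ^ s)⁻¹ * (((n : ℝ) ^ (-(1/b))) ^ c)⁻¹)
      Filter.atTop (nhds 0) := by
  have ha : 0 < s - c / b := sub_pos.2 ((div_lt_iff₀' hb).2 hc)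
  have hlim := (tendsto_natCast_rpow_neg ha).const_mul ((2 * k : ℝ) ^ s)
  rw [mul_zero] at hlim
  refine squeeze_zero' (Filter.Eventually.of_forall fun n => by positivity) ?_ hlim
  filter_upwards [Filter.eventually_ge_atTop k] with n hn
  have hN : 1 ≤ n / k := (Nat.one_le_div_iff hk).2 hn
  have hnpos : (0 : ℝ) < n := by exact_mod_cast hk.trans_le hn
  have hle : (n : ℝ) ≤ 2 * k * (n / k : ℕ) := by
    have h1 := Nat.div_add_mod n k
    have h2 := Nat.mod_lt n hk
    have h3 : k ≤ k * (n / k) := Nat.le_mul_of_pos_right k hN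
    have : n ≤ 2 * k * (n / k) := by
      rw [mul_assoc]
      omega
    exact_mod_cast this
  have hNpos : (0 : ℝ) < (n / k : ℕ) := by exact_mod_cast hN
  have hpow : (((n / k : ℕ) : ℝ) ^ s)⁻¹ ≤ (2 * k : ℝ) ^ s * ((n : ℝ) ^ s)⁻¹ := by
    rw [← div_eq_mul_inv, le_div_iff₀ (by positivity), inv_mul_le_iff₀ (by positivity),
      mul_comm, ← mul_pow]
    exact pow_le_pow_left₀ hnpos.le hle s
  calc _ ≤ (2 * k : ℝ) ^ s * ((n : ℝ) ^ s)⁻¹ * (((n : ℝ) ^ (-(1/b))) ^ c)⁻¹ := by gcongr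
    _ = _ := by
      rw [mul_assoc]
      congr 1
      rw [← Real.rpow_natCast, ← Real.rpow_natCast, ← Real.rpow_mul hnpos.le,
        ← Real.rpow_neg hnpos.le, ← Real.rpow_neg hnpos.le, ← Real.rpow_add hnpos]
      congr 1
      ring

/-- Bipartite graphs all of whose subgraphs have density less than `b` appear in
`G(n, n^{-1/b})` with probability tending to one. -/
theorem tendsto_erdosRenyi_copies {V : Type*} [Fintype V] [DecidableEq V] [Nonempty V]
    (E : Finset (V × V)) (hE : ∀ e ∈ E, ∀ e' ∈ E, e.1 ≠ e'.2) {b : ℝ} (hb : 0 < b)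
    (hdens : ∀ S : Finset V, S.Nonempty →
      ((E.filter fun e => e.1 ∈ S ∧ e.2 ∈ S).card : ℝ) < b * S.card) :
    Filter.Tendsto (fun n : ℕ => (erdosRenyi n ((n : ℝ) ^ (-(1/b)))).real
      {ω | ∃ g : V → Fin n, Function.Injective g ∧ ∀ e ∈ E, Adj ω (g e.1) (g e.2)})
      Filter.atTop (nhds 1) := by
  have hk : 0 < Fintype.card V := Fintype.card_pos
  have hlim : Filter.Tendsto (fun n : ℕ => ∑ S : Finset V,
      (((n / Fintype.card V : ℕ) : ℝ) ^ S.card)⁻¹ *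
        (((n : ℝ) ^ (-(1/b))) ^ (E.filter fun e => e.1 ∈ S ∧ e.2 ∈ S).card)⁻¹)
      Filter.atTop (nhds 1) := by
    suffices h : ∀ S ∈ (Finset.univ : Finset (Finset V)), Filter.Tendsto (fun n : ℕ =>
        (((n / Fintype.card V : ℕ) : ℝ) ^ S.card)⁻¹ *
          (((n : ℝ) ^ (-(1/b))) ^ (E.filter fun e => e.1 ∈ S ∧ e.2 ∈ S).card)⁻¹)
        Filter.atTop (nhds (if S = ∅ then 1 else 0)) by
      simpa only [Finset.sum_ite_eq', Finset.mem_univ, if_true] using tendsto_finsetSum _ h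
    intro S _
    split_ifs with hS
    · simp [hS]
    · exact tendsto_inv_blockSize_pow_mul _ hk hb
        (hdens S (Finset.nonempty_iff_ne_empty.2 hS))
  have hinv := hlim.inv₀ one_ne_zero
  rw [inv_one] at hinv
  refine tendsto_of_tendsto_of_tendsto_of_le_of_le' hinv tendsto_const_nhds ?_ ?_
  · filter_upwards [Filter.eventually_ge_atTop (Fintype.card V), hlim.eventually_const_lt one_pos]
      with n hn hpos
    obtain ⟨h0, h1⟩ := natCast_rpow_mem_Ioc (hk.trans_le hn) hb
    rw [inv_le_iff_one_le_mul₀' hpos]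
    exact one_le_mul_measureReal_copies E hE (Nat.div_pos hn hk) (Nat.mul_div_le _ _) h0 h1
  · filter_upwards [Filter.eventually_ge_atTop 1] with n hn
    obtain ⟨h0, h1⟩ := natCast_rpow_mem_Ioc hn hb
    have := erdosRenyi_isProbabilityMeasure n h0.le h1
    exact measureReal_le_one

/-- Convergence of real-valued Erdős–Rényi probabilities gives convergence in `ℝ≥0∞`. -/
theorem tendsto_erdosRenyi_of_real {b : ℝ} (hb : 0 < b) {A : ∀ n, Set (EdgeCfg n)} {x : ℝ}
    (h : Filter.Tendsto (fun n : ℕ => (erdosRenyi n ((n : ℝ) ^ (-(1/b)))).real (A n))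
      Filter.atTop (nhds x)) :
    Filter.Tendsto (fun n : ℕ => erdosRenyi n ((n : ℝ) ^ (-(1/b))) (A n))
      Filter.atTop (nhds (ENNReal.ofReal x)) := by
  refine (ENNReal.tendsto_ofReal h).congr' ?_
  filter_upwards [Filter.eventually_ge_atTop 1] with n hn
  obtain ⟨h0, h1⟩ := natCast_rpow_mem_Ioc hn hb
  have := erdosRenyi_isProbabilityMeasure n h0.le h1
  exact ofReal_measureReal

/-- A copy of the witness graph `H(X,W)` gives a copy of `X` in the `m`-neighbor complex. -/
theorem exists_copy_of_adj {X : Finset (Finset ℕ)} {m n : ℕ} {W : Finset ℕ → Finset ℕ}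
    (hW : WitnessAdm X m W) {ω : EdgeCfg n} {ρ : ℕ → Fin n}
    (hρ : Set.InjOn ρ (vertexSet X ∪ (facets X).biUnion W : Finset ℕ))
    (hadj : ∀ f ∈ facets X, ∀ u ∈ f, ∀ w ∈ W f, Adj ω (ρ u) (ρ w)) :
    ∀ f ∈ facets X, IsFace ω m (f.image ρ) := by
  classical
  intro f hf
  have hmemW {w} (hw : w ∈ W f) : w ∈ (facets X).biUnion W := Finset.mem_biUnion.2 ⟨f, hf, hw⟩
  have hWsub : (W f : Set ℕ) ⊆ (vertexSet X ∪ (facets X).biUnion W : Finset ℕ) := fun w hw =>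
    Finset.mem_coe.2 (Finset.mem_union_right _ (hmemW hw))
  rw [IsFace, ← hW.1 f hf, ← Finset.card_image_of_injOn (hρ.mono hWsub)]
  refine Finset.card_le_card fun v hv => ?_
  obtain ⟨w, hw, rfl⟩ := Finset.mem_image.1 hv
  refine Finset.mem_filter.2 ⟨Finset.mem_univ _, fun hmem => ?_, fun x hx => ?_⟩
  · obtain ⟨u, hu, huw⟩ := Finset.mem_image.1 hmem
    have hu' := mem_vertexSet hf hu
    have : u = w := hρ (Finset.mem_coe.2 (Finset.mem_union_left _ hu')) (hWsub hw) huw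
    subst this
    have := Finset.mem_inter.2 ⟨hmemW hw, hu'⟩
    rw [hW.2] at this
    exact absurd this (Finset.notMem_empty _)
  · obtain ⟨u, hu, rfl⟩ := Finset.mem_image.1 hx
    exact (hadj f hf u hu w hw).symm

/-- The witness assignments exist, so `mDensity` is an infimum over a nonempty set. -/
theorem exists_witnessAdm (X : Finset (Finset ℕ)) (m : ℕ) : ∃ W, WitnessAdm X m W := by
  refine ⟨fun _ => (Finset.range m).image (· + ((vertexSet X).sup id + 1)), fun f _ => ?_, ?_⟩
  · rw [Finset.card_image_of_injective _ (add_left_injective _), Finset.card_range]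
  · ext w
    simp only [Finset.mem_inter, Finset.mem_biUnion, Finset.mem_image, Finset.notMem_empty,
      iff_false, not_and]
    rintro ⟨f, -, i, -, rfl⟩ hw
    have : i + ((vertexSet X).sup id + 1) ≤ (vertexSet X).sup id := Finset.le_sup (f := id) hw
    omega

/-- A copy of `X` appears with probability tending to one above the density of `H(X,W)`. -/
theorem tendsto_erdosRenyi_copy {X : Finset (Finset ℕ)} (hne : (vertexSet X).Nonempty) {m : ℕ}
    {W : Finset ℕ → Finset ℕ} (hW : WitnessAdm X m W) {b : ℝ} (hb : dbar X W < b) :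
    Filter.Tendsto (fun n : ℕ => (erdosRenyi n ((n : ℝ) ^ (-(1/b)))).real
      {ω | ∃ ρ : ℕ → Fin n, Set.InjOn ρ (vertexSet X : Set ℕ) ∧
        ∀ f ∈ facets X, IsFace ω m (f.image ρ)}) Filter.atTop (nhds 1) := by
  classical
  have hb0 : 0 < b := (dbar_nonneg X W).trans_lt hb
  set U := vertexSet X ∪ (facets X).biUnion W with hU
  obtain ⟨u₀, hu₀⟩ : U.Nonempty := hne.mono Finset.subset_union_left
  have : Nonempty U := ⟨⟨u₀, hu₀⟩⟩
  set E₀ := (facets X).biUnion fun f => f ×ˢ W f with hE₀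
  let E : Finset (U × U) := Finset.univ.filter fun e => (e.1.1, e.2.1) ∈ E₀
  have hE₀mem {e : ℕ × ℕ} (he : e ∈ E₀) : e.1 ∈ vertexSet X ∧ e.2 ∈ (facets X).biUnion W := by
    obtain ⟨f, hf, he⟩ := Finset.mem_biUnion.1 he
    obtain ⟨h1, h2⟩ := Finset.mem_product.1 he
    exact ⟨mem_vertexSet hf h1, Finset.mem_biUnion.2 ⟨f, hf, h2⟩⟩
  have hE : ∀ e ∈ E, ∀ e' ∈ E, e.1 ≠ e'.2 := by
    intro e he e' he' h
    have h1 := (hE₀mem (Finset.mem_filter.1 he).2).1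
    have h2 := (hE₀mem (Finset.mem_filter.1 he').2).2
    have := Finset.mem_inter.2 ⟨h2, h ▸ h1⟩
    rw [hW.2] at this
    exact absurd this (Finset.notMem_empty _)
  have hdens (S : Finset U) (hS : S.Nonempty) :
      ((E.filter fun e => e.1 ∈ S ∧ e.2 ∈ S).card : ℝ) < b * S.card := by
    have hsub : S.map (Function.Embedding.subtype _) ⊆ U := fun x hx => by
      obtain ⟨y, -, rfl⟩ := Finset.mem_map.1 hx
      exact y.2
    have hle : (E.filter fun e => e.1 ∈ S ∧ e.2 ∈ S).card ≤
        (E₀.filter fun e => e.1 ∈ S.map (Function.Embedding.subtype _) ∧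
          e.2 ∈ S.map (Function.Embedding.subtype _)).card := by
      refine Finset.card_le_card_of_injOn (fun e => (e.1.1, e.2.1)) (fun e he => ?_)
        (Subtype.val_injective.prodMap Subtype.val_injective).injOn
      obtain ⟨h1, h2, h3⟩ := Finset.mem_filter.1 he
      exact Finset.mem_coe.2 (Finset.mem_filter.2 ⟨(Finset.mem_filter.1 h1).2,
        Finset.mem_map_of_mem _ h2, Finset.mem_map_of_mem _ h3⟩)
    have hd := card_filter_le_dbar_mul (hS.map (f := Function.Embedding.subtype _)) hsub
    rw [Finset.card_map] at hd
    calc _ ≤ _ := Nat.cast_le.2 hle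
      _ ≤ _ := hd
      _ < _ := by
        have : (0 : ℝ) < S.card := by exact_mod_cast hS.card_pos
        gcongr
  refine tendsto_of_tendsto_of_tendsto_of_le_of_le' (tendsto_erdosRenyi_copies E hE hb0 hdens)
    tendsto_const_nhds ?_ ?_ <;> filter_upwards [Filter.eventually_ge_atTop 1] with n hn <;>
    obtain ⟨h0, h1⟩ := natCast_rpow_mem_Ioc hn hb0 <;>
    have := erdosRenyi_isProbabilityMeasure n h0.le h1
  · refine measureReal_mono ?_
    rintro ω ⟨g, hg, hadj⟩
    let ρ : ℕ → Fin n := fun u => if h : u ∈ U then g ⟨u, h⟩ else g ⟨u₀, hu₀⟩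
    have hρU {u} (h : u ∈ U) : ρ u = g ⟨u, h⟩ := dif_pos h
    have hρ : Set.InjOn ρ (U : Set ℕ) := fun u hu v hv h => by
      rw [hρU hu, hρU hv] at h
      exact congrArg Subtype.val (hg h)
    refine ⟨ρ, hρ.mono (Finset.coe_subset.2 Finset.subset_union_left),
      exists_copy_of_adj hW hρ fun f hf u hu w hw => ?_⟩
    have he : (u, w) ∈ E₀ := Finset.mem_biUnion.2 ⟨f, hf, Finset.mem_product.2 ⟨hu, hw⟩⟩
    have huU : u ∈ U := Finset.mem_union_left _ (hE₀mem he).1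
    have hwU : w ∈ U := Finset.mem_union_right _ (hE₀mem he).2
    rw [hρU huU, hρU hwU]
    exact hadj (⟨u, huU⟩, ⟨w, hwU⟩) (Finset.mem_filter.2 ⟨Finset.mem_univ _, he⟩)
  · exact measureReal_le_one

/-- Theorem 2: the $m$-density of $X$ is a threshold for the appearance of a copy of $X$
in the $m$-neighbor complex of $G(n, n^{-1/b})$. -/
theorem stmt17 (X : Finset (Finset ℕ))
    (hdc : ∀ s ∈ X, ∀ t ⊆ s, t ∈ X)
    (hne : (vertexSet X).Nonempty)
    (hfac : ∃ f ∈ facets X, f.Nonempty)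
    (m : ℕ) (hm : 1 ≤ m) (b : ℝ) :
    (mDensity X m < b →
      Filter.Tendsto
        (fun n : ℕ => erdosRenyi n ((n : ℝ) ^ (-(1/b)))
          {ω | ∃ ρ : ℕ → Fin n, Set.InjOn ρ (vertexSet X : Set ℕ) ∧
            ∀ f ∈ facets X, IsFace ω m (f.image ρ)})
        Filter.atTop (nhds 1)) ∧
    (0 < b → b < mDensity X m →
      Filter.Tendsto
        (fun n : ℕ => erdosRenyi n ((n : ℝ) ^ (-(1/b)))
          {ω | ∃ ρ : ℕ → Fin n, Set.InjOn ρ (vertexSet X : Set ℕ) ∧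
            ∀ f ∈ facets X, IsFace ω m (f.image ρ)})
        Filter.atTop (nhds 0)) := by
  constructor
  · intro hb
    obtain ⟨W₀, hW₀⟩ := exists_witnessAdm X m
    obtain ⟨_, ⟨W, hW, rfl⟩, hlt⟩ := exists_lt_of_csInf_lt
      (by exact ⟨_, W₀, hW₀, rfl⟩) hb
    rw [← ENNReal.ofReal_one]
    exact tendsto_erdosRenyi_of_real ((dbar_nonneg X W).trans_lt hlt)
      (tendsto_erdosRenyi_copy hne hW hlt)
  · intro hb hlt
    rw [← ENNReal.ofReal_zero]
    refine tendsto_erdosRenyi_of_real hb (squeeze_zero'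
      (Filter.Eventually.of_forall fun n => measureReal_nonneg) ?_
      (tendsto_erdosRenyi_dense ((vertexSet X).card + (facets X).card * m) hb hlt))
    filter_upwards [Filter.eventually_ge_atTop 1] with n hn
    obtain ⟨h0, h1⟩ := natCast_rpow_mem_Ioc hn hb
    have := erdosRenyi_isProbabilityMeasure n h0.le h1
    refine measureReal_mono ?_
    rintro ω ⟨ρ, hρ, hface⟩
    exact exists_dense_of_copy hne hρ hface
end
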